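/- arXiv:2508.00084 — 5 statements merged into one kernel-verified Lean document; each statement's English description precedes it below -/
import Mathlib

section
/- Let F be a field of characteristic ≠ 2 and let T, S be strictly lower triangular n×n matrices over F. An invertible n×n matrix Γ = [γ_{ij}] over F defines a graded algebra isomorphism γ : A(T) → A(S) via X_j ↦ ∑_i γ_{ij} Y_i if and only if for all 1 ≤ r ≤ n and all 1 ≤ i < k ≤ n: 2γ_{ir}γ_{kr} + γ_{kr}² s_{ki} = ∑_{j<r} t_{rj}(γ_{kj}γ_{kr} s_{ki} + γ_{kj}γ_{ir} + γ_{ij}γ_{kr}). -/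
open MvPolynomial

noncomputable section

variable (F : Type) [Field F]

/-- The defining relations of the nil graded algebra `A(T)`. -/
def relSet {n : ℕ} (T : Matrix (Fin n) (Fin n) F) : Set (MvPolynomial (Fin n) F) :=
  { p | ∃ i : Fin n,
      p = X i ^ 2 - ∑ j ∈ Finset.univ.filter (fun j => j < i), C (T i j) * X j * X i }

/-- The nil graded algebra `A(T)` associated to a strictly lower triangular matrix `T`. -/
abbrev NTAlg {n : ℕ} (T : Matrix (Fin n) (Fin n) F) : Type :=
  MvPolynomial (Fin n) F ⧸ Ideal.span (relSet F T)

/-- The generators `X i` of `A(T)`. -/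
def NTgen {n : ℕ} (T : Matrix (Fin n) (Fin n) F) (i : Fin n) : NTAlg F T :=
  Ideal.Quotient.mk _ (X i)

/-- An algebra isomorphism is degree preserving iff it (and its inverse) maps the span
of the degree-2 generators into the span of the degree-2 generators. -/
def IsGradedIso {n : ℕ} {T S : Matrix (Fin n) (Fin n) F}
    (e : NTAlg F T ≃ₐ[F] NTAlg F S) : Prop :=
  (∀ j, e (NTgen F T j) ∈ Submodule.span F (Set.range (NTgen F S))) ∧
  (∀ j, e.symm (NTgen F S j) ∈ Submodule.span F (Set.range (NTgen F T)))

/-- `A(T)` and `A(S)` are isomorphic in the category 𝒩𝒯. -/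
def NTIso {n : ℕ} (T S : Matrix (Fin n) (Fin n) F) : Prop :=
  ∃ e : NTAlg F T ≃ₐ[F] NTAlg F S, IsGradedIso F e

/-- A matrix is strictly lower triangular. -/
def SLTM {n : ℕ} (T : Matrix (Fin n) (Fin n) F) : Prop :=
  ∀ i j : Fin n, i ≤ j → T i j = 0

/-- The key system of equations (Theorem `theo-Key-condition`). -/
def KeyEq {n : ℕ} (T S Γ : Matrix (Fin n) (Fin n) F) : Prop :=
  ∀ r i k : Fin n, i < k →
    2 * Γ i r * Γ k r + Γ k r ^ 2 * S k i =
      ∑ j ∈ Finset.univ.filter (fun j => j < r),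
        T r j * (Γ k j * Γ k r * S k i + Γ k j * Γ i r + Γ i j * Γ k r)

/-- The `i`-th defining relation. -/
def ntrel {n : ℕ} (T : Matrix (Fin n) (Fin n) F) (i : Fin n) : MvPolynomial (Fin n) F :=
  X i ^ 2 - ∑ j ∈ Finset.univ.filter (fun j => j < i), C (T i j) * X j * X i

lemma relSet_eq {n : ℕ} (T : Matrix (Fin n) (Fin n) F) : relSet F T = Set.range (ntrel F T) := by
  ext p
  simp [relSet, ntrel, eq_comm]

/-- The linear form with coefficients `l`. -/
def linf {n : ℕ} (l : Fin n → F) : MvPolynomial (Fin n) F := ∑ i, C (l i) * X i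

/-- Second derivative at the origin. -/
def dd {n : ℕ} (i k : Fin n) (p : MvPolynomial (Fin n) F) : F :=
  constantCoeff (pderiv i (pderiv k p))

lemma dd_add {n : ℕ} (i k : Fin n) (p q : MvPolynomial (Fin n) F) :
    dd F i k (p + q) = dd F i k p + dd F i k q := by simp [dd]

lemma dd_sub {n : ℕ} (i k : Fin n) (p q : MvPolynomial (Fin n) F) :
    dd F i k (p - q) = dd F i k p - dd F i k q := by simp [dd]

lemma dd_sum {n : ℕ} {ι : Type} (s : Finset ι) (i k : Fin n) (p : ι → MvPolynomial (Fin n) F) :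
    dd F i k (∑ a ∈ s, p a) = ∑ a ∈ s, dd F i k (p a) := by simp [dd, map_sum]

lemma dd_C_mul {n : ℕ} (i k : Fin n) (a : F) (q : MvPolynomial (Fin n) F) :
    dd F i k (C a * q) = a * dd F i k q := by simp [dd]

lemma dd_mul {n : ℕ} (i k : Fin n) (p q : MvPolynomial (Fin n) F) :
    dd F i k (p * q) = dd F i k p * constantCoeff q
      + constantCoeff (pderiv k p) * constantCoeff (pderiv i q)
      + constantCoeff (pderiv i p) * constantCoeff (pderiv k q)
      + constantCoeff p * dd F i k q := by
  simp [dd, Derivation.leibniz]; ring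

lemma cc_pderiv_X {n : ℕ} (i k : Fin n) :
    constantCoeff (pderiv i (X k : MvPolynomial (Fin n) F)) = if k = i then 1 else 0 := by
  rw [pderiv_X, Pi.single_apply]; split_ifs <;> simp

lemma cc_linf {n : ℕ} (l : Fin n → F) : constantCoeff (linf F l) = 0 := by
  simp [linf, map_sum]

lemma cc_pderiv_linf {n : ℕ} (l : Fin n → F) (i : Fin n) :
    constantCoeff (pderiv i (linf F l)) = l i := by
  simp only [linf, map_sum, pderiv_C_mul, smul_eq_C_mul, map_mul, constantCoeff_C, cc_pderiv_X]
  simp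

lemma dd_linf_mul {n : ℕ} (l m : Fin n → F) (i k : Fin n) :
    dd F i k (linf F l * linf F m) = l k * m i + l i * m k := by
  rw [dd_mul]; simp [cc_linf, cc_pderiv_linf]

lemma dd_XX {n : ℕ} (a b i k : Fin n) :
    dd F i k (X a * X b) = (if a = k then 1 else 0) * (if b = i then 1 else 0)
      + (if a = i then 1 else 0) * (if b = k then 1 else 0) := by
  rw [dd_mul]; simp only [cc_pderiv_X]; simp

lemma dd_ntrel {n : ℕ} (T : Matrix (Fin n) (Fin n) F) (i k m : Fin n) (h : i < k) :
    dd F i k (ntrel F T m) = if m = k then - T k i else 0 := by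
  simp only [ntrel, dd_sub, dd_sum, pow_two, mul_assoc, dd_C_mul, dd_XX]
  have h1 : ¬ (m = k ∧ m = i) := by rintro ⟨rfl, rfl⟩; exact lt_irrefl _ h
  by_cases hk : m = k
  · subst hk
    rw [Finset.sum_eq_single_of_mem i (by simp [h])]
    · simp [h.ne, h.ne']
    · intro b hb hbi
      simp at hb
      simp [hb.ne, hbi]
  · simp only [hk, if_false, mul_zero, zero_mul, zero_add, add_zero, zero_sub, neg_eq_zero]
    apply Finset.sum_eq_zero
    intro b hb
    simp at hb
    by_cases hi : m = i
    · subst hi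
      simp [(hb.trans h).ne]
    · simp [hi]

lemma dd_ntrel_diag {n : ℕ} (T : Matrix (Fin n) (Fin n) F) (k m : Fin n) :
    dd F k k (ntrel F T m) = if m = k then 2 else 0 := by
  simp only [ntrel, dd_sub, dd_sum, pow_two, mul_assoc, dd_C_mul, dd_XX]
  rw [Finset.sum_eq_zero]
  · split_ifs <;> norm_num
  · intro b hb
    simp at hb
    by_cases hk : m = k
    · subst hk; simp [hb.ne]
    · simp [hk]

lemma cc_ntrel {n : ℕ} (T : Matrix (Fin n) (Fin n) F) (m : Fin n) :
    constantCoeff (ntrel F T m) = 0 := by simp [ntrel, map_sum]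

lemma cc_pderiv_ntrel {n : ℕ} (T : Matrix (Fin n) (Fin n) F) (m i : Fin n) :
    constantCoeff (pderiv i (ntrel F T m)) = 0 := by
  simp [ntrel, map_sum, Derivation.leibniz, pow_two]

/-- Vanishing of the functional on the ideal. -/
lemma psi_ideal {n : ℕ} (S : Matrix (Fin n) (Fin n) F) (i k : Fin n) (h : i < k)
    (p : MvPolynomial (Fin n) F) (hp : p ∈ Ideal.span (relSet F S)) :
    2 * dd F i k p + S k i * dd F k k p = 0 := by
  rw [relSet_eq] at hp
  induction hp using Submodule.span_induction with
  | mem x hx =>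
    obtain ⟨m, rfl⟩ := hx
    rw [dd_ntrel F S i k m h, dd_ntrel_diag]
    split_ifs <;> ring
  | zero => simp [dd]
  | add x y _ _ hx hy => rw [dd_add, dd_add]; linear_combination hx + hy
  | smul a x hx0 hx =>
    have h0 : ∀ x ∈ Ideal.span (Set.range (ntrel F S)), constantCoeff x = 0 ∧
        ∀ i, constantCoeff (pderiv i x) = 0 := by
      intro x hx
      induction hx using Submodule.span_induction with
      | mem x hx =>
        obtain ⟨m, rfl⟩ := hx
        exact ⟨cc_ntrel F S m, cc_pderiv_ntrel F S m⟩
      | zero => simp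
      | add x y _ _ hx hy => simp [hx.1, hy.1, hx.2, hy.2]
      | smul a x _ hx => simp [hx.1, hx.2, Derivation.leibniz]
    obtain ⟨h1, h3⟩ := h0 x hx0
    rw [smul_eq_mul, dd_mul, dd_mul]
    simp only [h1, h3]
    linear_combination constantCoeff a * hx

/-- The image of the `r`-th relation under the substitution `Γ`. -/
def imrel {n : ℕ} (T Γ : Matrix (Fin n) (Fin n) F) (r : Fin n) : MvPolynomial (Fin n) F :=
  linf F (fun i => Γ i r) * linf F (fun i => Γ i r)
    - ∑ j ∈ Finset.univ.filter (fun j => j < r),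
        C (T r j) * (linf F (fun i => Γ i j) * linf F (fun i => Γ i r))

/-- The substitution. -/
def subst {n : ℕ} (Γ : Matrix (Fin n) (Fin n) F) :
    MvPolynomial (Fin n) F →ₐ[F] MvPolynomial (Fin n) F :=
  aeval (fun j => linf F (fun i => Γ i j))

lemma subst_ntrel {n : ℕ} (T Γ : Matrix (Fin n) (Fin n) F) (r : Fin n) :
    subst F Γ (ntrel F T r) = imrel F T Γ r := by
  simp only [subst, ntrel, imrel, map_sub, map_sum, map_mul, map_pow, aeval_X, pow_two, mul_assoc,
    algHom_C, MvPolynomial.algebraMap_eq]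

lemma subst_linf {n : ℕ} (Γ : Matrix (Fin n) (Fin n) F) (l : Fin n → F) :
    subst F Γ (linf F l) = linf F (Γ.mulVec l) := by
  simp only [subst, linf, map_sum, map_mul, aeval_X, algHom_C, MvPolynomial.algebraMap_eq,
    Matrix.mulVec, dotProduct, Finset.mul_sum, Finset.sum_mul]
  rw [Finset.sum_comm]
  refine Finset.sum_congr rfl fun i _ => Finset.sum_congr rfl fun j _ => ?_
  ring

lemma subst_comp {n : ℕ} (A B : Matrix (Fin n) (Fin n) F) (h : A * B = 1) :
    (subst F A).comp (subst F B) = AlgHom.id F _ := by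
  apply MvPolynomial.algHom_ext
  intro j
  have : subst F B (X j) = linf F (fun i => B i j) := by simp [subst]
  rw [AlgHom.comp_apply, this, subst_linf]
  have hcol : A.mulVec (fun i => B i j) = (1 : Matrix (Fin n) (Fin n) F).col j := by
    rw [← h]; rfl
  rw [hcol]
  simp [linf, Matrix.one_apply]

lemma linf_mul {n : ℕ} (S : Matrix (Fin n) (Fin n) F) (l m : Fin n → F) :
    linf F l * linf F m = ∑ k, C (l k * m k) * ntrel F S k
      + ∑ k, ∑ i ∈ Finset.univ.filter (fun i => i < k),
        C (m k * l k * S k i + l k * m i + l i * m k) * (X i * X k) := by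
  have e1 : ∀ k, C (l k * m k) * ntrel F S k + ∑ i ∈ Finset.univ.filter (fun i => i < k),
        C (m k * l k * S k i + l k * m i + l i * m k) * (X i * X k)
      = C (l k * m k) * X k ^ 2 + ∑ i ∈ Finset.univ.filter (fun i => i < k),
        C (l k * m i + l i * m k) * (X i * X k) := by
    intro k
    rw [ntrel, mul_sub, Finset.mul_sum, sub_add, ← Finset.sum_sub_distrib, sub_eq_add_neg,
      ← Finset.sum_neg_distrib]
    congr 1
    refine Finset.sum_congr rfl fun i _ => ?_
    simp only [map_add, map_mul]; ring
  rw [← Finset.sum_add_distrib, Finset.sum_congr rfl (fun k _ => e1 k)]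
  have e2 : linf F l * linf F m = ∑ k, ∑ i, (C (l k * m i) * (X k * X i)) := by
    rw [linf, linf, Finset.sum_mul_sum]
    refine Finset.sum_congr rfl fun i _ => Finset.sum_congr rfl fun j _ => ?_
    simp only [map_mul]; ring
  have e3 : ∀ k, ∑ i, (C (l k * m i) * (X k * X i) : MvPolynomial (Fin n) F)
      = C (l k * m k) * X k ^ 2 + ∑ i, (if i < k then C (l k * m i) * (X k * X i) else 0)
        + ∑ i, (if k < i then C (l k * m i) * (X k * X i) else 0) := by
    intro k
    have : C (l k * m k) * X k ^ 2 =
      ∑ i, (if i = k then C (l k * m i) * (X k * X i) else 0 : MvPolynomial (Fin n) F) := by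
      simp [pow_two]
    rw [this, ← Finset.sum_add_distrib, ← Finset.sum_add_distrib]
    refine Finset.sum_congr rfl fun i _ => ?_
    rcases lt_trichotomy i k with h | h | h
    · simp [h, h.ne, h.not_gt]
    · simp [h]
    · simp [h, h.ne', h.not_gt]
  rw [e2, Finset.sum_congr rfl (fun k _ => e3 k), Finset.sum_add_distrib, Finset.sum_comm (f :=
    fun k i => (if k < i then C (l k * m i) * (X k * X i) else 0 : MvPolynomial (Fin n) F)),
    ← Finset.sum_add_distrib]
  refine Finset.sum_congr rfl fun k _ => ?_
  rw [add_assoc, ← Finset.sum_add_distrib, Finset.sum_filter]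
  congr 1
  refine Finset.sum_congr rfl fun i _ => ?_
  split_ifs
  · simp only [map_add, map_mul]; ring
  · simp

lemma imrel_mem {n : ℕ} (T S Γ : Matrix (Fin n) (Fin n) F) (hK : KeyEq F T S Γ) (r : Fin n) :
    imrel F T Γ r ∈ Submodule.span F (Set.range (ntrel F S)) := by
  have key : imrel F T Γ r = ∑ k, (Γ k r * Γ k r -
      ∑ j ∈ Finset.univ.filter (fun j => j < r), T r j * (Γ k j * Γ k r)) • ntrel F S k := by
    have hz : ∀ k, ∀ i ∈ Finset.univ.filter (fun i => i < k),
        (C (Γ k r * Γ k r * S k i + Γ k r * Γ i r + Γ i r * Γ k r) * (X i * X k) :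
          MvPolynomial (Fin n) F) = ∑ j ∈ Finset.univ.filter (fun j => j < r),
          C (T r j) * (C (Γ k r * Γ k j * S k i + Γ k j * Γ i r + Γ i j * Γ k r)
            * (X i * X k)) := by
      intro k i hi
      simp at hi
      have := hK r i k hi
      simp only [← mul_assoc, ← map_mul]
      simp only [mul_assoc]
      rw [← Finset.sum_mul, ← map_sum]
      congr 2
      calc _ = 2 * Γ i r * Γ k r + Γ k r ^ 2 * S k i := by ring
        _ = _ := this
        _ = _ := Finset.sum_congr rfl fun j _ => by ring
    have hj : ∀ j, C (T r j) * (linf F (fun i => Γ i j) * linf F (fun i => Γ i r)) = _ :=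
      fun j => congrArg (C (T r j) * ·) (linf_mul F S (fun i => Γ i j) (fun i => Γ i r))
    rw [imrel, linf_mul F S]
    simp only [hj]
    rw [Finset.sum_congr rfl (fun k _ => Finset.sum_congr rfl (hz k))]
    simp only [mul_add, Finset.sum_add_distrib, Finset.mul_sum, sub_smul, Finset.sum_sub_distrib,
      smul_eq_C_mul, map_sum, Finset.sum_mul]
    have c1 : ∀ f : Fin n → Fin n → Fin n → MvPolynomial (Fin n) F,
        ∑ k, ∑ i ∈ Finset.univ.filter (fun i => i < k),
          ∑ j ∈ Finset.univ.filter (fun j => j < r), f k i j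
        = ∑ j ∈ Finset.univ.filter (fun j => j < r), ∑ k,
          ∑ i ∈ Finset.univ.filter (fun i => i < k), f k i j := by
      intro f
      rw [Finset.sum_comm]
      refine Finset.sum_congr rfl fun k _ => Finset.sum_comm
    rw [c1, add_sub_add_right_eq_sub]
    congr 1
    rw [Finset.sum_comm]
    refine Finset.sum_congr rfl fun k _ => Finset.sum_congr rfl fun j _ => ?_
    simp only [map_mul]; ring
  rw [key]
  exact Submodule.sum_mem _ fun k _ => Submodule.smul_mem _ _ (Submodule.subset_span ⟨k, rfl⟩)

lemma ntrel_li {n : ℕ} (h2 : (2 : F) ≠ 0) (T : Matrix (Fin n) (Fin n) F) :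
    LinearIndependent F (ntrel F T) := by
  rw [Fintype.linearIndependent_iff]
  intro g hg k
  have := congrArg (dd F k k) hg
  simp only [smul_eq_C_mul, dd_sum, dd_C_mul, dd_ntrel_diag] at this
  simpa [dd, h2] using this

/-- Theorem (key condition): an invertible matrix `Γ` defines a graded isomorphism
`A(T) → A(S)` via `X_j ↦ ∑ᵢ γᵢⱼ Yᵢ` iff the key system of equations holds. -/
theorem stmt1 {n : ℕ} (h2 : (2 : F) ≠ 0) (T S : Matrix (Fin n) (Fin n) F)
    (hT : SLTM F T) (hS : SLTM F S) (Γ : Matrix (Fin n) (Fin n) F) (hΓ : IsUnit Γ) :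
    (∃ e : NTAlg F T ≃ₐ[F] NTAlg F S,
        ∀ j : Fin n, e (NTgen F T j) = ∑ i : Fin n, Γ i j • NTgen F S i) ↔
      KeyEq F T S Γ := by
  have mk_linf : ∀ l : Fin n → F,
      (Ideal.Quotient.mk (Ideal.span (relSet F S)) (linf F l)) = ∑ i, l i • NTgen F S i := by
    intro l
    rw [linf, map_sum]
    refine Finset.sum_congr rfl fun i _ => ?_
    rw [← smul_eq_C_mul]; rfl
  constructor
  · rintro ⟨e, he⟩ r i k hik
    have hcomp : ((e : NTAlg F T →ₐ[F] NTAlg F S).comp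
        (Ideal.Quotient.mkₐ F (Ideal.span (relSet F T)))) =
        (Ideal.Quotient.mkₐ F (Ideal.span (relSet F S))).comp (subst F Γ) := by
      apply MvPolynomial.algHom_ext
      intro j
      have h1 : subst F Γ (X j) = linf F (fun i => Γ i j) := by simp [subst]
      rw [AlgHom.comp_apply, AlgHom.comp_apply, h1]
      exact (he j).trans (mk_linf _).symm
    have hr := DFunLike.congr_fun hcomp (ntrel F T r)
    rw [AlgHom.comp_apply, AlgHom.comp_apply, subst_ntrel] at hr
    have h0 : Ideal.Quotient.mkₐ F (Ideal.span (relSet F T)) (ntrel F T r) = 0 :=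
      Ideal.Quotient.eq_zero_iff_mem.2 (Ideal.subset_span ⟨r, rfl⟩)
    rw [h0, map_zero] at hr
    have hm : imrel F T Γ r ∈ Ideal.span (relSet F S) := Ideal.Quotient.eq_zero_iff_mem.1 hr.symm
    have hp := psi_ideal F S i k hik _ hm
    simp only [imrel, dd_sub, dd_sum, dd_C_mul, dd_linf_mul] at hp
    apply mul_left_cancel₀ h2
    have hs : (2 : F) * ∑ j ∈ Finset.univ.filter (fun j => j < r),
        T r j * (Γ k j * Γ k r * S k i + Γ k j * Γ i r + Γ i j * Γ k r)
        = 2 * ∑ j ∈ Finset.univ.filter (fun j => j < r), T r j * (Γ k j * Γ i r + Γ i j * Γ k r)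
        + S k i * ∑ j ∈ Finset.univ.filter (fun j => j < r),
          T r j * (Γ k j * Γ k r + Γ k j * Γ k r) := by
      rw [Finset.mul_sum, Finset.mul_sum, Finset.mul_sum, ← Finset.sum_add_distrib]
      exact Finset.sum_congr rfl fun j _ => by ring
    rw [hs]
    linear_combination hp
  · intro hK
    have hdet : IsUnit Γ.det := (Matrix.isUnit_iff_isUnit_det Γ).1 hΓ
    let g : MvPolynomial (Fin n) F ≃ₐ[F] MvPolynomial (Fin n) F :=
      AlgEquiv.ofAlgHom (subst F Γ) (subst F Γ⁻¹)
        (subst_comp F _ _ (Matrix.mul_nonsing_inv Γ hdet))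
        (subst_comp F _ _ (Matrix.nonsing_inv_mul Γ hdet))
    have hg : ∀ p, g p = subst F Γ p := fun p => rfl
    have hle : Submodule.span F (Set.range fun r => imrel F T Γ r) ≤
        Submodule.span F (Set.range (ntrel F S)) := by
      rw [Submodule.span_le]
      rintro _ ⟨r, rfl⟩
      exact imrel_mem F T S Γ hK r
    have hli : LinearIndependent F (fun r => imrel F T Γ r) := by
      have := (ntrel_li F h2 T).map' g.toLinearMap
        (LinearMap.ker_eq_bot.2 g.injective)
      have hf : (fun r => imrel F T Γ r) = g.toLinearMap ∘ ntrel F T := by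
        funext r
        exact (subst_ntrel F T Γ r).symm
      rw [hf]
      exact this
    have heq : Submodule.span F (Set.range fun r => imrel F T Γ r) =
        Submodule.span F (Set.range (ntrel F S)) := by
      have : FiniteDimensional F (Submodule.span F (Set.range (ntrel F S))) :=
        FiniteDimensional.span_of_finite F (Set.finite_range _)
      apply Submodule.eq_of_le_of_finrank_eq hle
      rw [finrank_span_eq_card hli, finrank_span_eq_card (ntrel_li F h2 S)]
    have hI : Ideal.span (relSet F S) = (Ideal.span (relSet F T)).map
        (g : MvPolynomial (Fin n) F →+* MvPolynomial (Fin n) F) := by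
      have him : Set.image (g : MvPolynomial (Fin n) F →+* MvPolynomial (Fin n) F) (relSet F T)
          = Set.range fun r => imrel F T Γ r := by
        rw [relSet_eq, ← Set.range_comp]
        congr 1
        funext r
        exact subst_ntrel F T Γ r
      rw [Ideal.map_span, him, relSet_eq]
      have hsub : ∀ s : Set (MvPolynomial (Fin n) F), ∀ x ∈ Submodule.span F s,
          x ∈ Ideal.span s := fun s x hx =>
        Submodule.span_le_restrictScalars F (MvPolynomial (Fin n) F) s hx
      apply le_antisymm
      · rw [Ideal.span_le]
        intro x hx
        apply hsub
        rw [heq]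
        exact Submodule.subset_span hx
      · rw [Ideal.span_le]
        intro x hx
        exact hsub _ _ (hle (Submodule.subset_span hx))
    refine ⟨Ideal.quotientEquivAlg _ _ g hI, fun j => ?_⟩
    have h1 : subst F Γ (X j) = linf F (fun i => Γ i j) := by simp [subst]
    rw [← mk_linf, ← h1]
    rfl
end
end

section
/- Let F be a field of characteristic ≠ 2, and let u, v ∈ F \ {0} with u ≠ v. Consider the 4×4 strictly lower triangular matrices T with rows (0,0,0,0), (0,0,0,0), (1,1,0,0), (u,1,0,0) and S with rows (0,0,0,0), (0,0,0,0), (1,1,0,0), (v,1,0,0). Then the graded algebras A(T) and A(S) are isomorphic if and only if u/v is a square in F. -/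
open MvPolynomial

noncomputable section

variable (F : Type) [Field F]

/-- The matrix family of the statement. -/
abbrev Mx (u : F) : Matrix (Fin 4) (Fin 4) F :=
  !![(0:F),0,0,0; 0,0,0,0; 1,1,0,0; u,1,0,0]

/-- The defining polynomials of the ideal of `A(Mx u)`. -/
theorem mem_relSet_Mx (u : F) (p : MvPolynomial (Fin 4) F) : p ∈ relSet F (Mx F u) ↔
    p = X 0 ^ 2 ∨ p = X 1 ^ 2 ∨ p = X 2 ^ 2 - (X 0 + X 1) * X 2 ∨
      p = X 3 ^ 2 - (C u * X 0 + X 1) * X 3 := by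
  have f0 : Finset.univ.filter (fun j : Fin 4 => j < 0) = ∅ := by decide
  have f1 : Finset.univ.filter (fun j : Fin 4 => j < 1) = {0} := by decide
  have f2 : Finset.univ.filter (fun j : Fin 4 => j < 2) = {0, 1} := by decide
  have f3 : Finset.univ.filter (fun j : Fin 4 => j < 3) = {0, 1, 2} := by decide
  have key : ∀ P : Fin 4 → Prop, (∃ i, P i) ↔ P 0 ∨ P 1 ∨ P 2 ∨ P 3 := by
    intro P
    constructor
    · rintro ⟨i, hi⟩
      fin_cases i <;> simp_all
    · rintro (h | h | h | h) <;> exact ⟨_, h⟩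
  simp only [relSet, Set.mem_ofPred_eq, key, f0, f1, f2, f3]
  simp [add_mul]

/-- Homomorphisms out of `A(Mx u)`. -/
theorem exists_hom (u : F) {B : Type} [CommRing B] [Algebra F B] (g : Fin 4 → B)
    (h0 : g 0 ^ 2 = 0) (h1 : g 1 ^ 2 = 0) (h2 : g 2 ^ 2 = (g 0 + g 1) * g 2)
    (h3 : g 3 ^ 2 = (algebraMap F B u * g 0 + g 1) * g 3) :
    ∃ f : NTAlg F (Mx F u) →ₐ[F] B, ∀ i, f (NTgen F (Mx F u) i) = g i := by
  refine ⟨Ideal.Quotient.liftₐ _ (aeval g) ?_, fun i => ?_⟩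
  · intro a ha
    have : Ideal.span (relSet F (Mx F u)) ≤ RingHom.ker (aeval g : _ →ₐ[F] B) := by
      rw [Ideal.span_le]
      intro p hp
      rw [mem_relSet_Mx] at hp
      rw [SetLike.mem_coe, RingHom.mem_ker]
      rcases hp with rfl | rfl | rfl | rfl <;> simp [h0, h1, h2, h3]
    exact this ha
  · change aeval g (X i) = g i
    simp

theorem gen_rel (u : F) :
    NTgen F (Mx F u) 0 ^ 2 = 0 ∧ NTgen F (Mx F u) 1 ^ 2 = 0 ∧
    NTgen F (Mx F u) 2 ^ 2 = (NTgen F (Mx F u) 0 + NTgen F (Mx F u) 1) * NTgen F (Mx F u) 2 ∧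
    NTgen F (Mx F u) 3 ^ 2 =
      (algebraMap F _ u * NTgen F (Mx F u) 0 + NTgen F (Mx F u) 1) * NTgen F (Mx F u) 3 := by
  have H : ∀ p ∈ relSet F (Mx F u),
      Ideal.Quotient.mk (Ideal.span (relSet F (Mx F u))) p = 0 := fun p hp =>
    Ideal.Quotient.eq_zero_iff_mem.2 (Ideal.subset_span hp)
  simp only [mem_relSet_Mx] at H
  have e : algebraMap F (NTAlg F (Mx F u)) u = Ideal.Quotient.mk _ (C u) := rfl
  simp only [NTgen, e]
  refine ⟨?_, ?_, ?_, ?_⟩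
  · rw [← map_pow]; exact H _ (by simp)
  · rw [← map_pow]; exact H _ (by simp)
  · rw [← sub_eq_zero]; simpa only [map_sub, map_mul, map_add, map_pow] using H _ (Or.inr (Or.inr (Or.inl rfl)))
  · rw [← sub_eq_zero]; simpa only [map_sub, map_mul, map_add, map_pow] using H _ (Or.inr (Or.inr (Or.inr rfl)))

/-- Vectors of degree one have unique coordinates modulo the ideal. -/
theorem pderiv_zero (u : F) (p : MvPolynomial (Fin 4) F)
    (hp : p ∈ Ideal.span (relSet F (Mx F u))) :
    eval 0 p = 0 ∧ ∀ i, eval 0 (pderiv i p) = 0 := by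
  induction hp using Submodule.span_induction with
  | mem x hx =>
    rw [mem_relSet_Mx] at hx
    rcases hx with rfl | rfl | rfl | rfl <;> simp
  | zero => simp
  | add x y _ _ h1 h2 =>
    refine ⟨by rw [map_add, h1.1, h2.1, add_zero], fun i => ?_⟩
    rw [map_add, map_add, h1.2, h2.2, add_zero]
  | smul a x _ h =>
    refine ⟨by rw [smul_eq_mul, map_mul, h.1, mul_zero], fun i => ?_⟩
    rw [smul_eq_mul, Derivation.leibniz, map_add, smul_eq_mul, smul_eq_mul, map_mul, map_mul,
      h.1, h.2, mul_zero, zero_mul, add_zero]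

theorem pderiv2_zero (u : F) (p : MvPolynomial (Fin 4) F)
    (hp : p ∈ Ideal.span (relSet F (Mx F u))) (D : Fin 4 → Fin 4 → F)
    (hD : D = fun i j => eval 0 (pderiv i (pderiv j p))) :
    D 0 1 = 0 ∧ 2 * D 0 2 + D 2 2 = 0 ∧ 2 * D 1 2 + D 2 2 = 0 ∧
      2 * D 0 3 + u * D 3 3 = 0 ∧ 2 * D 1 3 + D 3 3 = 0 ∧ D 2 3 = 0 := by
  subst hD
  have cc2 : constantCoeff (2 : MvPolynomial (Fin 4) F) = 2 := map_ofNat constantCoeff 2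
  induction hp using Submodule.span_induction with
  | mem x hx =>
    rw [mem_relSet_Mx] at hx
    rcases hx with rfl | rfl | rfl | rfl <;> simp [pderiv_X, cc2] <;> ring_nf
  | zero => simp
  | add x y _ _ h1 h2 =>
    obtain ⟨a1, a2, a3, a4, a5, a6⟩ := h1
    obtain ⟨b1, b2, b3, b4, b5, b6⟩ := h2
    simp only [map_add]
    refine ⟨?_, ?_, ?_, ?_, ?_, ?_⟩
    · linear_combination a1 + b1
    · linear_combination a2 + b2
    · linear_combination a3 + b3
    · linear_combination a4 + b4
    · linear_combination a5 + b5
    · linear_combination a6 + b6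
  | smul a x hx h1 =>
    obtain ⟨a1, a2, a3, a4, a5, a6⟩ := h1
    obtain ⟨e0, e1⟩ := pderiv_zero F u x hx
    simp only [smul_eq_mul, Derivation.leibniz, map_add, map_mul, e0, e1, mul_zero, zero_mul,
      add_zero]
    refine ⟨?_, ?_, ?_, ?_, ?_, ?_⟩
    · linear_combination eval 0 a * a1
    · linear_combination eval 0 a * a2
    · linear_combination eval 0 a * a3
    · linear_combination eval 0 a * a4
    · linear_combination eval 0 a * a5
    · linear_combination eval 0 a * a6

/-- Diagonal coordinates `a, b, c, d` on an algebra: `a² = b² = 0`, `2c² = ab`, `2d² = w·ab`,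
with no further relation in the two lowest degrees. -/
structure Good {A : Type} [CommRing A] [Algebra F A] (w : F) (a b c d : A) : Prop where
  ha : a ^ 2 = 0
  hb : b ^ 2 = 0
  hc : 2 * c ^ 2 = a * b
  hd : 2 * d ^ 2 = algebraMap F A w * (a * b)
  ind1 : ∀ p q r s : F, algebraMap F A p * a + algebraMap F A q * b + algebraMap F A r * c +
    algebraMap F A s * d = 0 → p = 0 ∧ q = 0 ∧ r = 0 ∧ s = 0
  ind2 : ∀ p q r s t k : F, algebraMap F A p * (a * b) + algebraMap F A q * (a * c) +
    algebraMap F A r * (a * d) + algebraMap F A s * (b * c) + algebraMap F A t * (b * d) +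
    algebraMap F A k * (c * d) = 0 → p = 0 ∧ q = 0 ∧ r = 0 ∧ s = 0 ∧ t = 0 ∧ k = 0

/-- `x` is a linear combination of `a, b, c, d`. -/
def Comb {A : Type} [CommRing A] [Algebra F A] (a b c d x : A) : Prop :=
  ∃ p q r s : F, x = algebraMap F A p * a + algebraMap F A q * b + algebraMap F A r * c +
    algebraMap F A s * d

variable {F}

theorem Good.sq {A : Type} [CommRing A] [Algebra F A] {w : F} {a b c d : A}
    (h : Good F w a b c d) (h2 : (2 : F) ≠ 0) (p q r s m : F)
    (H : 2 * (algebraMap F A p * a + algebraMap F A q * b + algebraMap F A r * c +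
      algebraMap F A s * d) ^ 2 = algebraMap F A m * (a * b)) :
    4 * p * q + r ^ 2 + w * s ^ 2 = m ∧ p * r = 0 ∧ p * s = 0 ∧ q * r = 0 ∧ q * s = 0 ∧
      r * s = 0 := by
  have := h.ind2 (4 * p * q + r ^ 2 + w * s ^ 2 - m) (4 * p * r) (4 * p * s) (4 * q * r)
    (4 * q * s) (4 * r * s) (by
      simp only [map_sub, map_add, map_mul, map_pow, map_ofNat]
      linear_combination H - 2 * algebraMap F A p ^ 2 * h.ha - 2 * algebraMap F A q ^ 2 * h.hb
        - algebraMap F A r ^ 2 * h.hc - algebraMap F A s ^ 2 * h.hd)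
  have h4 : (4 : F) ≠ 0 := by
    have : (4 : F) = 2 * 2 := by norm_num
    rw [this]; exact mul_ne_zero h2 h2
  obtain ⟨e1, e2, e3, e4, e5, e6⟩ := this
  refine ⟨sub_eq_zero.1 e1, ?_, ?_, ?_, ?_, ?_⟩ <;> simp_all [mul_assoc]

/-- Square-zero degree-one elements are proportional to `a` or `b`. -/
theorem Good.nil {A : Type} [CommRing A] [Algebra F A] {w : F} {a b c d : A}
    (h : Good F w a b c d) (h2 : (2 : F) ≠ 0) (hw : w ≠ 0) (x : A) (hx : Comb F a b c d x)
    (hx2 : x ^ 2 = 0) :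
    ∃ p : F, x = algebraMap F A p * a ∨ x = algebraMap F A p * b := by
  obtain ⟨p, q, r, s, rfl⟩ := hx
  obtain ⟨e1, e2, e3, e4, e5, e6⟩ := h.sq h2 p q r s 0 (by rw [hx2]; simp)
  by_cases hp : p = 0
  · subst hp
    by_cases hq : q = 0
    · subst hq
      rcases mul_eq_zero.1 e6 with rfl | rfl
      · have : s = 0 := by simpa [hw] using e1
        subst this
        exact ⟨0, by simp⟩
      · have : r = 0 := by simpa using e1
        subst this
        exact ⟨0, by simp⟩
    · have hr : r = 0 := by simpa [hq] using e4
      have hs : s = 0 := by simpa [hq] using e5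
      subst hr hs
      exact ⟨q, by simp⟩
  · have hr : r = 0 := by simpa [hp] using e2
    have hs : s = 0 := by simpa [hp] using e3
    subst hr hs
    have h4 : (4 : F) ≠ 0 := by
      have : (4 : F) = 2 * 2 := by norm_num
      rw [this]; exact mul_ne_zero h2 h2
    have hq : q = 0 := by simpa [hp, h4] using e1
    subst hq
    exact ⟨p, by simp⟩

/-- Degree-one elements whose square is a multiple of `ab`. -/
theorem Good.sqab {A : Type} [CommRing A] [Algebra F A] {w : F} {a b c d : A}
    (h : Good F w a b c d) (h2 : (2 : F) ≠ 0) (x : A) (hx : Comb F a b c d x) (m : F)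
    (hx2 : 2 * x ^ 2 = algebraMap F A m * (a * b)) :
    (∃ p q : F, x = algebraMap F A p * a + algebraMap F A q * b) ∨
    (∃ r : F, x = algebraMap F A r * c ∧ r ^ 2 = m) ∨
    (∃ s : F, x = algebraMap F A s * d ∧ w * s ^ 2 = m) := by
  obtain ⟨p, q, r, s, rfl⟩ := hx
  obtain ⟨e1, e2, e3, e4, e5, e6⟩ := h.sq h2 p q r s m hx2
  by_cases hr : r = 0
  · subst hr
    by_cases hs : s = 0
    · subst hs
      exact Or.inl ⟨p, q, by simp⟩
    · have hp : p = 0 := by simpa [hs] using e3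
      have hq : q = 0 := by simpa [hs] using e5
      subst hp hq
      exact Or.inr (Or.inr ⟨s, by simp, by simpa using e1⟩)
  · have hp : p = 0 := by simpa [hr] using e2
    have hq : q = 0 := by simpa [hr] using e4
    have hs : s = 0 := by simpa [hr] using e6
    subst hp hq hs
    exact Or.inr (Or.inl ⟨r, by simp, by simpa using e1⟩)

/-- The images `x, y` of `a, b` are, up to scalars and order, `a, b` again. -/
theorem Good.square {A : Type} [CommRing A] [Algebra F A] {u v : F} {a b c d x y z t : A}
    (h : Good F v a b c d) (h2 : (2 : F) ≠ 0) (hu : u ≠ 0) (hv : v ≠ 0)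
    (g : Good F u x y z t)
    (hx : Comb F a b c d x) (hy : Comb F a b c d y) (hz : Comb F a b c d z)
    (ht : Comb F a b c d t) : ∃ ε : F, u / v = ε ^ 2 := by
  -- the case distinction on `x, y`, packaged symmetrically
  have main : ∃ m : F, m ≠ 0 ∧ x * y = algebraMap F A m * (a * b) ∧
      ∀ p q : F, ∃ p' q' : F, algebraMap F A p * a + algebraMap F A q * b =
        algebraMap F A p' * x + algebraMap F A q' * y := by
    have hx0 : x ≠ 0 := by
      intro h0
      have := g.ind1 1 0 0 0 (by simp [h0])
      exact one_ne_zero this.1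
    have hy0 : y ≠ 0 := by
      intro h0
      have := g.ind1 0 1 0 0 (by simp [h0])
      exact one_ne_zero this.2.1
    obtain ⟨m, hm⟩ := h.nil h2 hv x hx g.ha
    obtain ⟨n, hn⟩ := h.nil h2 hv y hy g.hb
    have hm0 : m ≠ 0 := by
      rintro rfl
      simp at hm
      exact hx0 hm
    have hn0 : n ≠ 0 := by
      rintro rfl
      simp at hn
      exact hy0 hn
    have cancel : ∀ p k : F, k ≠ 0 → ∀ e : A,
        algebraMap F A (p / k) * (algebraMap F A k * e) = algebraMap F A p * e := by
      intro p k hk e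
      rw [← mul_assoc, ← map_mul, div_mul_cancel₀ p hk]
    have indep : ∀ e : A, x = algebraMap F A m * e → y = algebraMap F A n * e → False := by
      intro e h1 h3
      have := g.ind1 n (-m) 0 0 (by rw [h1, h3]; simp; ring)
      exact hn0 this.1
    rcases hm with hm | hm <;> rcases hn with hn | hn
    · exact (indep a hm hn).elim
    · refine ⟨m * n, mul_ne_zero hm0 hn0, by rw [hm, hn, map_mul]; ring, fun p q => ?_⟩
      refine ⟨p / m, q / n, ?_⟩
      rw [hm, hn, cancel _ _ hm0, cancel _ _ hn0]
    · refine ⟨m * n, mul_ne_zero hm0 hn0, by rw [hm, hn, map_mul]; ring, fun p q => ?_⟩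
      refine ⟨q / m, p / n, ?_⟩
      rw [hm, hn, cancel _ _ hm0, cancel _ _ hn0, add_comm]
    · exact (indep b hm hn).elim
  obtain ⟨m, hm0, hxy, hspan⟩ := main
  have hz2 : 2 * z ^ 2 = algebraMap F A m * (a * b) := by rw [g.hc, hxy]
  have ht2 : 2 * t ^ 2 = algebraMap F A (u * m) * (a * b) := by
    rw [g.hd, hxy, map_mul, mul_assoc]
  have hum : u * m ≠ 0 := mul_ne_zero hu hm0
  have indep : ∀ (p q : F) (e : A), z = algebraMap F A p * e → t = algebraMap F A q * e →
      p ≠ 0 → False := by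
    intro p q e h1 h3 hp
    have := g.ind1 0 0 q (-p) (by rw [h1, h3]; simp; ring)
    exact hp (neg_eq_zero.1 this.2.2.2)
  rcases h.sqab h2 z hz m hz2 with ⟨p, q, e⟩ | ⟨r, er, hr⟩ | ⟨r, er, hr⟩
  · obtain ⟨p', q', e'⟩ := hspan p q
    have := g.ind1 p' q' (-1) 0 (by rw [← e', ← e]; simp)
    simp at this
  · have hr0 : r ≠ 0 := by rintro rfl; exact hm0 (by rw [← hr]; simp)
    rcases h.sqab h2 t ht _ ht2 with ⟨p, q, e⟩ | ⟨s, es, hs⟩ | ⟨s, es, hs⟩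
    · obtain ⟨p', q', e'⟩ := hspan p q
      have := g.ind1 p' q' 0 (-1) (by rw [← e', ← e]; simp)
      simp at this
    · exact (indep r s c er es hr0).elim
    · refine ⟨s / r, ?_⟩
      rw [div_pow, div_eq_div_iff hv (pow_ne_zero 2 hr0)]
      linear_combination u * hr - hs
  · have hr0 : r ≠ 0 := by rintro rfl; exact hm0 (by rw [← hr]; simp)
    rcases h.sqab h2 t ht _ ht2 with ⟨p, q, e⟩ | ⟨s, es, hs⟩ | ⟨s, es, hs⟩
    · obtain ⟨p', q', e'⟩ := hspan p q
      have := g.ind1 p' q' 0 (-1) (by rw [← e', ← e]; simp)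
      simp at this
    · refine ⟨s / (v * r), ?_⟩
      rw [div_pow, div_eq_div_iff hv (pow_ne_zero 2 (mul_ne_zero hv hr0))]
      linear_combination u * v * hr - v * hs
    · exact (indep r s d er es hr0).elim

/-- Goodness is transported along injective algebra maps. -/
theorem Good.map {A B : Type} [CommRing A] [Algebra F A] [CommRing B] [Algebra F B] {w : F}
    {a b c d : A} (h : Good F w a b c d) (f : A →ₐ[F] B) (hf : Function.Injective f) :
    Good F w (f a) (f b) (f c) (f d) where
  ha := by rw [← map_pow, h.ha, map_zero]
  hb := by rw [← map_pow, h.hb, map_zero]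
  hc := by rw [← map_mul f, ← h.hc, map_mul, map_ofNat, map_pow]
  hd := by rw [← map_mul f, ← f.commutes, ← map_mul f, ← h.hd, map_mul, map_ofNat, map_pow]
  ind1 := by
    intro p q r s H
    apply h.ind1 p q r s
    apply hf
    simpa using H
  ind2 := by
    intro p q r s t k H
    apply h.ind2 p q r s t k
    apply hf
    simpa using H

variable (F)

/-- `c = X₃ - (X₁ + X₂)/2`. -/
def cElt (u : F) : NTAlg F (Mx F u) :=
  NTgen F (Mx F u) 2 - algebraMap F _ (1 / 2) * (NTgen F (Mx F u) 0 + NTgen F (Mx F u) 1)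

/-- `d = X₄ - (u X₁ + X₂)/2`. -/
def dElt (u : F) : NTAlg F (Mx F u) :=
  NTgen F (Mx F u) 3 - algebraMap F _ (1 / 2) *
    (algebraMap F _ u * NTgen F (Mx F u) 0 + NTgen F (Mx F u) 1)

theorem good_Mx (h2 : (2 : F) ≠ 0) (u : F) :
    Good F u (NTgen F (Mx F u) 0) (NTgen F (Mx F u) 1) (cElt F u) (dElt F u) := by
  obtain ⟨g0, g1, g2, g3⟩ := gen_rel F u
  have hk : (2 : NTAlg F (Mx F u)) * algebraMap F _ (1 / 2) = 1 := by
    rw [← map_ofNat (algebraMap F (NTAlg F (Mx F u))) 2, ← map_mul, mul_one_div_cancel h2, map_one]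
  refine ⟨g0, g1, ?_, ?_, ?_, ?_⟩
  · unfold cElt
    generalize algebraMap F (NTAlg F (Mx F u)) (1 / 2) = k at *
    generalize NTgen F (Mx F u) 0 = a at *
    generalize NTgen F (Mx F u) 1 = b at *
    generalize NTgen F (Mx F u) 2 = c at *
    linear_combination 2 * g2 + 2 * k ^ 2 * g0 + 2 * k ^ 2 * g1 +
      (-2 * c * (a + b) + a * b * (2 * k + 1)) * hk
  · unfold dElt
    generalize algebraMap F (NTAlg F (Mx F u)) (1 / 2) = k at *
    generalize algebraMap F (NTAlg F (Mx F u)) u = w at *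
    generalize NTgen F (Mx F u) 0 = a at *
    generalize NTgen F (Mx F u) 1 = b at *
    generalize NTgen F (Mx F u) 3 = c at *
    linear_combination 2 * g3 + 2 * k ^ 2 * w ^ 2 * g0 + 2 * k ^ 2 * g1 +
      (-2 * c * (w * a + b) + w * a * b * (2 * k + 1)) * hk
  · intro p q r s H
    have H' : (C p * X 0 + C q * X 1 + C r * (X 2 - C (1 / 2) * (X 0 + X 1)) +
        C s * (X 3 - C (1 / 2) * (C u * X 0 + X 1)) : MvPolynomial (Fin 4) F) ∈
        Ideal.span (relSet F (Mx F u)) := by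
      rw [← Ideal.Quotient.eq_zero_iff_mem, ← H]
      rfl
    have D := (pderiv_zero F u _ H').2
    have D0 := D 0
    have D1 := D 1
    have D2 := D 2
    have D3 := D 3
    simp [pderiv_X] at D0 D1 D2 D3
    subst D2 D3
    simp_all
  · intro p q r s t k H
    have H' : (C p * (X 0 * X 1) + C q * (X 0 * (X 2 - C (1 / 2) * (X 0 + X 1))) +
        C r * (X 0 * (X 3 - C (1 / 2) * (C u * X 0 + X 1))) +
        C s * (X 1 * (X 2 - C (1 / 2) * (X 0 + X 1))) +
        C t * (X 1 * (X 3 - C (1 / 2) * (C u * X 0 + X 1))) +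
        C k * ((X 2 - C (1 / 2) * (X 0 + X 1)) * (X 3 - C (1 / 2) * (C u * X 0 + X 1))) :
          MvPolynomial (Fin 4) F) ∈ Ideal.span (relSet F (Mx F u)) := by
      rw [← Ideal.Quotient.eq_zero_iff_mem, ← H]
      rfl
    obtain ⟨D1, D2, D3, D4, D5, D6⟩ := pderiv2_zero F u _ H' _ rfl
    simp [pderiv_X] at D1 D2 D3 D4 D5 D6
    simp_all

theorem smul_NT (u k : F) (x : NTAlg F (Mx F u)) : k • x = algebraMap F _ k * x :=
  Algebra.smul_def k x

theorem alg_mul_mem (u k : F) (x : NTAlg F (Mx F u))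
    (hx : x ∈ Submodule.span F (Set.range (NTgen F (Mx F u)))) :
    algebraMap F _ k * x ∈ Submodule.span F (Set.range (NTgen F (Mx F u))) :=
  smul_NT F u k x ▸ Submodule.smul_mem _ k hx

theorem forall4 (P : Fin 4 → Prop) (h0 : P 0) (h1 : P 1) (h2 : P 2) (h3 : P 3) : ∀ i, P i := by
  intro i
  fin_cases i <;> assumption

theorem comb_of_span (u : F) (x : NTAlg F (Mx F u))
    (hx : x ∈ Submodule.span F (Set.range (NTgen F (Mx F u)))) :
    Comb F (NTgen F (Mx F u) 0) (NTgen F (Mx F u) 1) (cElt F u) (dElt F u) x := by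
  rw [Submodule.mem_span_range_iff_exists_fun] at hx
  obtain ⟨k, rfl⟩ := hx
  refine ⟨k 0 + k 2 * (1 / 2) + k 3 * (1 / 2) * u, k 1 + k 2 * (1 / 2) + k 3 * (1 / 2),
    k 2, k 3, ?_⟩
  simp only [Fin.sum_univ_four, smul_NT, cElt, dElt, map_add, map_mul]
  ring

theorem forward (h2 : (2 : F) ≠ 0) (u v : F) (hu : u ≠ 0) (hv : v ≠ 0)
    (H : NTIso F (Mx F u) (Mx F v)) : ∃ ε : F, u / v = ε ^ 2 := by
  obtain ⟨e, he, -⟩ := H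
  have g := (good_Mx F h2 u).map e.toAlgHom e.injective
  refine (good_Mx F h2 v).square h2 hu hv g ?_ ?_ ?_ ?_ <;> apply comb_of_span
  · exact he 0
  · exact he 1
  · have : e.toAlgHom (cElt F u) = e (NTgen F (Mx F u) 2) -
        algebraMap F _ (1 / 2) * (e (NTgen F (Mx F u) 0) + e (NTgen F (Mx F u) 1)) := by
      simp [cElt]
    rw [this]
    exact Submodule.sub_mem _ (he 2) (alg_mul_mem _ _ _ _ (Submodule.add_mem _ (he 0) (he 1)))
  · have : e.toAlgHom (dElt F u) = e (NTgen F (Mx F u) 3) - algebraMap F _ (1 / 2) *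
        (algebraMap F _ u * e (NTgen F (Mx F u) 0) + e (NTgen F (Mx F u) 1)) := by
      simp [dElt]
    rw [this]
    exact Submodule.sub_mem _ (he 3) (alg_mul_mem _ _ _ _
      (Submodule.add_mem _ (alg_mul_mem _ _ _ _ (he 0)) (he 1)))

/-- The explicit homomorphism rescaling `d` by `ε`. -/
theorem exists_scale (h2 : (2 : F) ≠ 0) (u v ε : F) (h : u = ε ^ 2 * v) :
    ∃ f : NTAlg F (Mx F u) →ₐ[F] NTAlg F (Mx F v),
      f (NTgen F (Mx F u) 0) = NTgen F (Mx F v) 0 ∧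
      f (NTgen F (Mx F u) 1) = NTgen F (Mx F v) 1 ∧
      f (NTgen F (Mx F u) 2) = NTgen F (Mx F v) 2 ∧
      f (NTgen F (Mx F u) 3) = algebraMap F _ ε * NTgen F (Mx F v) 3 +
        algebraMap F _ ((u - ε * v) / 2) * NTgen F (Mx F v) 0 + algebraMap F _ ((1 - ε) / 2) * NTgen F (Mx F v) 1 := by
  obtain ⟨g0, g1, g2, g3⟩ := gen_rel F v
  have hk : (2 : NTAlg F (Mx F v)) * algebraMap F _ (1 / 2) = 1 := by
    rw [← map_ofNat (algebraMap F (NTAlg F (Mx F v))) 2, ← map_mul, mul_one_div_cancel h2, map_one]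
  obtain ⟨f, hf⟩ := exists_hom F u ![NTgen F (Mx F v) 0, NTgen F (Mx F v) 1, NTgen F (Mx F v) 2,
    algebraMap F _ ε * NTgen F (Mx F v) 3 +
        algebraMap F _ ((u - ε * v) / 2) * NTgen F (Mx F v) 0 + algebraMap F _ ((1 - ε) / 2) * NTgen F (Mx F v) 1]
    g0 g1 g2 (by
      subst h
      change (algebraMap F _ ε * NTgen F (Mx F v) 3 +
        algebraMap F _ ((ε ^ 2 * v - ε * v) / 2) * NTgen F (Mx F v) 0 +
        algebraMap F _ ((1 - ε) / 2) * NTgen F (Mx F v) 1) ^ 2 =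
        (algebraMap F _ (ε ^ 2 * v) * NTgen F (Mx F v) 0 + NTgen F (Mx F v) 1) *
        (algebraMap F _ ε * NTgen F (Mx F v) 3 +
        algebraMap F _ ((ε ^ 2 * v - ε * v) / 2) * NTgen F (Mx F v) 0 +
        algebraMap F _ ((1 - ε) / 2) * NTgen F (Mx F v) 1)
      rw [div_eq_mul_one_div (ε ^ 2 * v - ε * v), div_eq_mul_one_div (1 - ε)]
      simp only [map_mul, map_sub, map_one, map_pow]
      generalize algebraMap F (NTAlg F (Mx F v)) (1 / 2) = k at *
      generalize algebraMap F (NTAlg F (Mx F v)) v = w at *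
      generalize algebraMap F (NTAlg F (Mx F v)) ε = z at *
      generalize NTgen F (Mx F v) 0 = a at *
      generalize NTgen F (Mx F v) 1 = b at *
      generalize NTgen F (Mx F v) 3 = c at *
      linear_combination z ^ 2 * g3 - z ^ 2 * c * (w * a + b) * hk +
        z * (c - k * (w * a + b)) * (z ^ 2 * w * a + b) * hk + z ^ 2 * k ^ 2 * (w ^ 2 * g0 + g1) +
        (k ^ 2 - k) * (z ^ 4 * w ^ 2 * g0 + g1) + 2 * a * b * z ^ 2 * w * k * hk)
  exact ⟨f, hf 0, hf 1, hf 2, hf 3⟩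

theorem hom_ext4 (u : F) (f g : NTAlg F (Mx F u) →ₐ[F] NTAlg F (Mx F u))
    (h : ∀ i, f (NTgen F (Mx F u) i) = g (NTgen F (Mx F u) i)) : f = g := by
  apply Ideal.Quotient.algHom_ext
  apply MvPolynomial.algHom_ext
  exact h

theorem comp_id (h2 : (2 : F) ≠ 0) (u v ε δ : F) (hε : ε * δ = 1) (h : u = ε ^ 2 * v)
    (f : NTAlg F (Mx F u) →ₐ[F] NTAlg F (Mx F v)) (g : NTAlg F (Mx F v) →ₐ[F] NTAlg F (Mx F u))
    (f0 : f (NTgen F (Mx F u) 0) = NTgen F (Mx F v) 0)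
    (f1 : f (NTgen F (Mx F u) 1) = NTgen F (Mx F v) 1)
    (f2 : f (NTgen F (Mx F u) 2) = NTgen F (Mx F v) 2)
    (f3 : f (NTgen F (Mx F u) 3) = algebraMap F _ ε * NTgen F (Mx F v) 3 +
        algebraMap F _ ((u - ε * v) / 2) * NTgen F (Mx F v) 0 + algebraMap F _ ((1 - ε) / 2) * NTgen F (Mx F v) 1)
    (g0 : g (NTgen F (Mx F v) 0) = NTgen F (Mx F u) 0)
    (g1 : g (NTgen F (Mx F v) 1) = NTgen F (Mx F u) 1)
    (g2 : g (NTgen F (Mx F v) 2) = NTgen F (Mx F u) 2)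
    (g3 : g (NTgen F (Mx F v) 3) = algebraMap F _ δ * NTgen F (Mx F u) 3 +
        algebraMap F _ ((v - δ * u) / 2) * NTgen F (Mx F u) 0 + algebraMap F _ ((1 - δ) / 2) * NTgen F (Mx F u) 1) :
    g.comp f = AlgHom.id F _ := by
  apply hom_ext4
  apply forall4
  · simp [f0, g0]
  · simp [f1, g1]
  · simp [f2, g2]
  · change g (f (NTgen F (Mx F u) 3)) = NTgen F (Mx F u) 3
    rw [f3]
    simp only [map_add, map_mul, AlgHom.commutes, g0, g1, g3]
    have e1 : ε * ((v - δ * u) / 2) + (u - ε * v) / 2 = 0 := by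
      field_simp
      linear_combination -u * hε
    have e2 : ε * ((1 - δ) / 2) + (1 - ε) / 2 = 0 := by
      field_simp
      linear_combination - hε
    have E0 := congrArg (algebraMap F (NTAlg F (Mx F u))) hε
    have E1 := congrArg (algebraMap F (NTAlg F (Mx F u))) e1
    have E2 := congrArg (algebraMap F (NTAlg F (Mx F u))) e2
    rw [map_mul, map_one] at E0
    rw [map_add, map_mul, map_zero] at E1 E2
    linear_combination NTgen F (Mx F u) 3 * E0 + NTgen F (Mx F u) 0 * E1 +
      NTgen F (Mx F u) 1 * E2

theorem backward (h2 : (2 : F) ≠ 0) (u v : F) (hu : u ≠ 0) (hv : v ≠ 0)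
    (H : ∃ ε : F, u / v = ε ^ 2) : NTIso F (Mx F u) (Mx F v) := by
  obtain ⟨ε, hε⟩ := H
  have h : u = ε ^ 2 * v := by rw [← hε, div_mul_cancel₀ u hv]
  have hε0 : ε ≠ 0 := by rintro rfl; exact hu (by simp [h])
  have h' : v = ε⁻¹ ^ 2 * u := by rw [h]; field_simp
  obtain ⟨f, f0, f1, f2, f3⟩ := exists_scale F h2 u v ε h
  obtain ⟨g, g0, g1, g2, g3⟩ := exists_scale F h2 v u ε⁻¹ h'
  have Sv : ∀ i, NTgen F (Mx F v) i ∈ Submodule.span F (Set.range (NTgen F (Mx F v))) :=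
    fun i => Submodule.subset_span ⟨i, rfl⟩
  have Su : ∀ i, NTgen F (Mx F u) i ∈ Submodule.span F (Set.range (NTgen F (Mx F u))) :=
    fun i => Submodule.subset_span ⟨i, rfl⟩
  have hf : ∀ i, f (NTgen F (Mx F u) i) ∈ Submodule.span F (Set.range (NTgen F (Mx F v))) := by
    apply forall4
    · rw [f0]; exact Sv 0
    · rw [f1]; exact Sv 1
    · rw [f2]; exact Sv 2
    · rw [f3]
      exact Submodule.add_mem _ (Submodule.add_mem _ (alg_mul_mem _ _ _ _ (Sv 3))
        (alg_mul_mem _ _ _ _ (Sv 0))) (alg_mul_mem _ _ _ _ (Sv 1))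
  have hg : ∀ i, g (NTgen F (Mx F v) i) ∈ Submodule.span F (Set.range (NTgen F (Mx F u))) := by
    apply forall4
    · rw [g0]; exact Su 0
    · rw [g1]; exact Su 1
    · rw [g2]; exact Su 2
    · rw [g3]
      exact Submodule.add_mem _ (Submodule.add_mem _ (alg_mul_mem _ _ _ _ (Su 3))
        (alg_mul_mem _ _ _ _ (Su 0))) (alg_mul_mem _ _ _ _ (Su 1))
  have fg := comp_id F h2 v u ε⁻¹ ε (inv_mul_cancel₀ hε0) h' g f g0 g1 g2 g3 f0 f1 f2 f3
  have gf := comp_id F h2 u v ε ε⁻¹ (mul_inv_cancel₀ hε0) h f g f0 f1 f2 f3 g0 g1 g2 g3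
  exact ⟨AlgEquiv.ofAlgHom f g fg gf, hf, hg⟩

/-- `A(T) ≅ A(S)` for the matrices with last rows `(u,1,0,0)` and `(v,1,0,0)`
iff `u/v` is a square in `F`. -/
theorem stmt2 (h2 : (2 : F) ≠ 0) (u v : F) (hu : u ≠ 0) (hv : v ≠ 0) (huv : u ≠ v) :
    NTIso F
        !![(0:F),0,0,0; 0,0,0,0; 1,1,0,0; u,1,0,0]
        !![(0:F),0,0,0; 0,0,0,0; 1,1,0,0; v,1,0,0] ↔
      ∃ ε : F, u / v = ε ^ 2 := by

  exact ⟨forward F h2 u v hu hv, backward F h2 u v hu hv⟩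
end
end

section
/- Let F be a field of characteristic ≠ 2 and let T and S be the 4×4 strictly lower triangular matrices over F with rows T: (0,0,0,0), (0,0,0,0), (1,1,0,0), (0,0,1,0) and S: (0,0,0,0), (0,0,0,0), (1,1,0,0), (u,v,1,0) for parameters u, v ∈ F. If A(T) ≅ A(S) as graded algebras, then u ≠ −1/2, v ≠ −1/2, and both 2uv + u + v + 1 and (2u+1)/(2v+1) are nonzero squares in F. -/
open MvPolynomial

noncomputable section

variable (F : Type) [Field F]

/-- The linear form with coefficients `a`. -/
def linForm (a : Fin 4 → F) : MvPolynomial (Fin 4) F := ∑ i, C (a i) * X i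

lemma pderiv_linForm (a : Fin 4 → F) (k : Fin 4) : pderiv k (linForm F a) = C (a k) := by
  simp [linForm, pderiv_X, Pi.single_apply]

lemma eval_linForm (a : Fin 4 → F) : eval (0 : Fin 4 → F) (linForm F a) = 0 := by
  simp [linForm]

/-- The functionals detecting the degree one and degree two parts. -/
def Kills (S : Matrix (Fin 4) (Fin 4) F) (p : MvPolynomial (Fin 4) F) : Prop :=
  eval (0 : Fin 4 → F) p = 0 ∧ (∀ i, eval (0 : Fin 4 → F) (pderiv i p) = 0) ∧
  ∀ i k, i < k → 2 * eval (0 : Fin 4 → F) (pderiv i (pderiv k p))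
    + S k i * eval (0 : Fin 4 → F) (pderiv k (pderiv k p)) = 0

lemma kills_rel (S : Matrix (Fin 4) (Fin 4) F) (p : MvPolynomial (Fin 4) F)
    (hp : p ∈ relSet F S) : Kills F S p := by
  obtain ⟨r, rfl⟩ := hp
  refine ⟨?_, ?_, ?_⟩
  · simp
  · intro i
    simp [Derivation.leibniz, Derivation.leibniz_pow]
  · intro i k hik
    rw [Finset.sum_filter]
    fin_cases r <;> fin_cases i <;> fin_cases k <;>
      first
      | exact absurd hik (by decide)
      | (simp [Fin.sum_univ_four, Derivation.leibniz, Derivation.leibniz_pow, pderiv_X,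
          show (constantCoeff (2 : MvPolynomial (Fin 4) F) : F) = 2 from map_ofNat _ 2]; try ring)

lemma kills_span (S : Matrix (Fin 4) (Fin 4) F) (p : MvPolynomial (Fin 4) F)
    (hp : p ∈ Ideal.span (relSet F S)) : Kills F S p := by
  induction hp using Submodule.span_induction with
  | mem x hx => exact kills_rel F S x hx
  | zero => exact ⟨by simp, by simp, by simp⟩
  | add x y _ _ hx hy =>
    refine ⟨by rw [map_add, hx.1, hy.1, add_zero],
      fun i => by rw [map_add, map_add, hx.2.1, hy.2.1, add_zero], fun i k h => ?_⟩
    have h1 := hx.2.2 i k h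
    have h2 := hy.2.2 i k h
    simp only [map_add]
    linear_combination h1 + h2
  | smul a x _ hx =>
    refine ⟨by rw [smul_eq_mul, map_mul, hx.1, mul_zero],
      fun i => by simp only [smul_eq_mul, Derivation.leibniz, map_add, map_mul, hx.1, hx.2.1,
        mul_zero, zero_mul, add_zero],
      fun i k h => ?_⟩
    have h1 := hx.2.2 i k h
    simp only [smul_eq_mul, Derivation.leibniz, map_add, map_mul, hx.1, hx.2.1]
    linear_combination (eval (0 : Fin 4 → F) a) * h1

/-- Degree two element of `A(S)` with given coordinates. -/
def linEl (S : Matrix (Fin 4) (Fin 4) F) (a : Fin 4 → F) : NTAlg F S :=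
  Ideal.Quotient.mk _ (linForm F a)

lemma linEl_inj (S : Matrix (Fin 4) (Fin 4) F) (a b : Fin 4 → F)
    (h : linEl F S a = linEl F S b) : a = b := by
  have := (kills_span F S _ (Ideal.Quotient.eq.1 h)).2.1
  funext i
  have := this i
  simp only [map_sub, pderiv_linForm, eval_C] at this
  exact sub_eq_zero.1 this

lemma linEl_mul (h2 : (2 : F) ≠ 0) (S : Matrix (Fin 4) (Fin 4) F) (a b c : Fin 4 → F)
    (h : linEl F S a * linEl F S a = linEl F S b * linEl F S c) (i k : Fin 4) (hik : i < k) :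
    2 * a i * a k + S k i * a k ^ 2 = b i * c k + b k * c i + S k i * b k * c k := by
  have h' : (Ideal.Quotient.mk (Ideal.span (relSet F S))) (linForm F a * linForm F a)
      = (Ideal.Quotient.mk (Ideal.span (relSet F S))) (linForm F b * linForm F c) := by
    rw [map_mul, map_mul]; exact h
  have := (kills_span F S _ (Ideal.Quotient.eq.1 h')).2.2 i k hik
  simp only [map_sub, Derivation.leibniz, pderiv_linForm, eval_C, map_add, smul_eq_mul, map_mul,
    eval_linForm, pderiv_C, map_zero] at this
  apply mul_left_cancel₀ h2
  linear_combination this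

lemma linEl_sum (S : Matrix (Fin 4) (Fin 4) F) (a : Fin 4 → F) :
    linEl F S a = ∑ i, a i • NTgen F S i := by
  simp only [linEl, linForm, map_sum, NTgen]
  refine Finset.sum_congr rfl fun i _ => ?_
  rw [← smul_eq_C_mul]
  rfl

lemma linEl_add (S : Matrix (Fin 4) (Fin 4) F) (a b : Fin 4 → F) :
    linEl F S (a + b) = linEl F S a + linEl F S b := by
  simp [linEl_sum, add_smul, Finset.sum_add_distrib]

lemma linEl_zero (S : Matrix (Fin 4) (Fin 4) F) : linEl F S 0 = 0 := by
  simp [linEl_sum]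

lemma rel_zero (T : Matrix (Fin 4) (Fin 4) F) (r : Fin 4) :
    NTgen F T r * NTgen F T r =
      ∑ j, if j < r then T r j • (NTgen F T j * NTgen F T r) else 0 := by
  have h : Ideal.Quotient.mk (Ideal.span (relSet F T)) _ = 0 :=
    Ideal.Quotient.eq_zero_iff_mem.2 (Ideal.subset_span (⟨r, rfl⟩ : _ ∈ relSet F T))
  rw [map_sub, sub_eq_zero, map_sum, Finset.sum_filter, map_pow, sq] at h
  refine h.trans (Finset.sum_congr rfl fun j _ => ?_)
  split_ifs
  · rw [mul_assoc, ← smul_eq_C_mul]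
    rfl
  · rfl

/-- Square-zero elements in degree two. -/
lemma sq_zero_coords (h2 : (2 : F) ≠ 0) (u v : F) (a : Fin 4 → F)
    (h : linEl F !![(0:F),0,0,0; 0,0,0,0; 1,1,0,0; u,v,1,0] a *
      linEl F !![(0:F),0,0,0; 0,0,0,0; 1,1,0,0; u,v,1,0] a = 0) :
    a 2 = 0 ∧ a 3 = 0 ∧ a 0 * a 1 = 0 := by
  have H := linEl_mul F h2 !![(0:F),0,0,0; 0,0,0,0; 1,1,0,0; u,v,1,0] a 0 0
    (by rw [h, linEl_zero, mul_zero])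
  have h01 := H 0 1 (by decide)
  have h02 := H 0 2 (by decide)
  have h12 := H 1 2 (by decide)
  have h23 := H 2 3 (by decide)
  simp at h01 h02 h12 h23
  have e01 : a 0 * a 1 = 0 := by
    rcases h01 with (h | h) | h
    · exact absurd h h2
    · rw [h, zero_mul]
    · rw [h, mul_zero]
  have e2 : a 2 = 0 := by
    by_contra hne
    have k0 : 2 * a 0 + a 2 = 0 := mul_left_cancel₀ hne (by linear_combination h02)
    have k1 : 2 * a 1 + a 2 = 0 := mul_left_cancel₀ hne (by linear_combination h12)
    apply hne
    have : a 2 ^ 2 = 0 := by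
      linear_combination (a 2) * k0 - 2 * a 0 * k1 + 4 * e01
    exact pow_eq_zero_iff (two_ne_zero) |>.1 this
  refine ⟨e2, ?_, e01⟩
  rw [e2] at h23
  have : a 3 ^ 2 = 0 := by linear_combination h23
  exact pow_eq_zero_iff (two_ne_zero) |>.1 this

/-- The final algebra, in coordinates. -/
lemma final_coords (h2 : (2 : F) ≠ 0) (u v a b : F) (ha : a ≠ 0) (hb : b ≠ 0)
    (c0 c1 c2 c3 d0 d1 d2 d3 : F) (hdet : c2 * d3 - c3 * d2 ≠ 0)
    (p01 : 2 * c0 * c1 = a * c1 + b * c0)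
    (p02 : 2 * c0 * c2 + c2 ^ 2 = a * c2)
    (p12 : 2 * c1 * c2 + c2 ^ 2 = b * c2)
    (p03 : 2 * c0 * c3 + u * c3 ^ 2 = a * c3)
    (p13 : 2 * c1 * c3 + v * c3 ^ 2 = b * c3)
    (p23 : 2 * c2 * c3 + c3 ^ 2 = 0)
    (q01 : 2 * d0 * d1 = c0 * d1 + c1 * d0)
    (q02 : 2 * d0 * d2 + d2 ^ 2 = c0 * d2 + c2 * d0 + c2 * d2)
    (q12 : 2 * d1 * d2 + d2 ^ 2 = c1 * d2 + c2 * d1 + c2 * d2)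
    (q03 : 2 * d0 * d3 + u * d3 ^ 2 = c0 * d3 + c3 * d0 + u * c3 * d3)
    (q13 : 2 * d1 * d3 + v * d3 ^ 2 = c1 * d3 + c3 * d1 + v * c3 * d3)
    (q23 : 2 * d2 * d3 + d3 ^ 2 = c2 * d3 + c3 * d2 + c3 * d3) :
    u ≠ -(1/2) ∧ v ≠ -(1/2) ∧
    (∃ x : F, x ≠ 0 ∧ x ^ 2 = 2*u*v + u + v + 1) ∧
    (∃ y : F, y ≠ 0 ∧ y ^ 2 = (2*u + 1) / (2*v + 1)) := by
  have hc2 : c2 ≠ 0 := by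
    intro h
    have : c3 ^ 2 = 0 := by rw [h] at p23; linear_combination p23
    have : c3 = 0 := pow_eq_zero_iff (two_ne_zero) |>.1 this
    apply hdet; rw [h, this]; ring
  have r0 : 2 * c0 + c2 = a := mul_left_cancel₀ hc2 (by linear_combination p02)
  have r1 : 2 * c1 + c2 = b := mul_left_cancel₀ hc2 (by linear_combination p12)
  have rab : c2 ^ 2 = a * b := by
    rw [← r0, ← r1] at p01 ⊢
    linear_combination 2 * p01
  have hc3 : c3 = 0 := by
    by_contra hne
    have e : c3 = -2 * c2 := mul_left_cancel₀ hne (by linear_combination p23)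
    have s0 : 2 * c0 + u * c3 = a := mul_left_cancel₀ hne (by linear_combination p03)
    have hu : 2 * u = -1 := mul_left_cancel₀ hc2 (by rw [e] at s0; linear_combination r0 - s0)
    have hd : 2 * d2 + d3 ≠ 0 := by
      intro h; apply hdet; rw [e]; linear_combination c2 * h
    have hd3 : d3 = -c2 := mul_left_cancel₀ hd (by rw [e] at q23; linear_combination q23)
    apply ha
    apply mul_left_cancel₀ hc2
    rw [e, hd3] at q03
    rw [← r0]
    linear_combination 2 * q03 + c2 ^ 2 * hu
  subst hc3
  have hd3 : d3 ≠ 0 := by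
    rintro rfl; apply hdet; ring
  have t2 : 2 * d2 + d3 = c2 := mul_left_cancel₀ hd3 (by linear_combination q23)
  have t0 : 2 * d0 + u * d3 = c0 := mul_left_cancel₀ hd3 (by linear_combination q03)
  have t1 : 2 * d1 + v * d3 = c1 := mul_left_cancel₀ hd3 (by linear_combination q13)
  have w01 : d3 ^ 2 * (u * v) = c0 * c1 := by
    rw [← t0, ← t1] at q01 ⊢
    linear_combination 2 * q01
  have w02 : d3 ^ 2 * (2 * u + 1) = c2 * a := by
    rw [← r0]
    rw [← t0, ← t2] at q02 ⊢
    linear_combination 4 * q02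
  have w12 : d3 ^ 2 * (2 * v + 1) = c2 * b := by
    rw [← r1]
    rw [← t1, ← t2] at q12 ⊢
    linear_combination 4 * q12
  have nu : 2 * u + 1 ≠ 0 := by
    intro h; rw [h, mul_zero] at w02; exact mul_ne_zero hc2 ha w02.symm
  have nv : 2 * v + 1 ≠ 0 := by
    intro h; rw [h, mul_zero] at w12; exact mul_ne_zero hc2 hb w12.symm
  refine ⟨?_, ?_, ⟨c2 / d3, div_ne_zero hc2 hd3, ?_⟩, ⟨c2 / b, div_ne_zero hc2 hb, ?_⟩⟩
  · rintro rfl; apply nu; field_simp; ring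
  · rintro rfl; apply nv; field_simp; ring
  · rw [div_pow, div_eq_iff (pow_ne_zero 2 hd3)]
    apply mul_left_cancel₀ h2
    rw [← r0] at w02 rab
    rw [← r1] at w12 rab
    linear_combination -4 * w01 - w02 - w12 + rab
  · rw [div_pow, div_eq_div_iff (pow_ne_zero 2 hb) nv]
    apply mul_left_cancel₀ (pow_ne_zero 2 hd3)
    linear_combination c2 ^ 2 * w12 - b ^ 2 * w02 + c2 * b * rab

/-- Necessary conditions for `A(T) ≅ A(S)` with `T` having last row `(0,0,1,0)`
and `S` having last row `(u,v,1,0)`. -/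
theorem stmt7 (h2 : (2 : F) ≠ 0) (u v : F)
    (h : NTIso F
        !![(0:F),0,0,0; 0,0,0,0; 1,1,0,0; 0,0,1,0]
        !![(0:F),0,0,0; 0,0,0,0; 1,1,0,0; u,v,1,0]) :
    u ≠ -(1/2) ∧ v ≠ -(1/2) ∧
    (∃ x : F, x ≠ 0 ∧ x ^ 2 = 2*u*v + u + v + 1) ∧
    (∃ y : F, y ≠ 0 ∧ y ^ 2 = (2*u + 1) / (2*v + 1)) := by
  obtain ⟨e, he1, he2⟩ := h
  generalize hT : !![(0:F),0,0,0; 0,0,0,0; 1,1,0,0; 0,0,1,0] = T at e he1 he2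
  generalize hS : !![(0:F),0,0,0; 0,0,0,0; 1,1,0,0; u,v,1,0] = S at e he1 he2
  have hG : ∀ j, ∃ g : Fin 4 → F, linEl F S g = e (NTgen F T j) := fun j => by
    obtain ⟨g, hg⟩ := (Submodule.mem_span_range_iff_exists_fun F).1 (he1 j)
    exact ⟨g, by rw [linEl_sum, hg]⟩
  have hD : ∀ j, ∃ g : Fin 4 → F, linEl F T g = e.symm (NTgen F S j) := fun j => by
    obtain ⟨g, hg⟩ := (Submodule.mem_span_range_iff_exists_fun F).1 (he2 j)
    exact ⟨g, by rw [linEl_sum, hg]⟩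
  choose G hG using hG
  choose D hD using hD
  have hDG : Matrix.of D * Matrix.of G = 1 := by
    ext j i
    have key : linEl F S (fun i => (Matrix.of D * Matrix.of G) j i) =
        linEl F S (fun i => (1 : Matrix (Fin 4) (Fin 4) F) j i) := by
      have h1 : e (linEl F T (D j)) = NTgen F S j := by rw [hD]; simp
      rw [linEl_sum, map_sum] at h1
      simp only [map_smul, ← hG, linEl_sum, Finset.smul_sum, smul_smul] at h1
      rw [linEl_sum, linEl_sum]
      simp only [Matrix.one_apply, ite_smul, one_smul, zero_smul, Finset.sum_ite_eq,
        Finset.mem_univ, if_true]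
      rw [← h1, Finset.sum_comm]
      simp only [Matrix.mul_apply, Finset.sum_smul, Matrix.of_apply]
    exact congrFun (linEl_inj F S _ _ key) i
  have hdet : (Matrix.of G).det ≠ 0 := by
    intro h
    have := congrArg Matrix.det hDG
    rw [Matrix.det_mul, h, mul_zero, Matrix.det_one] at this
    exact zero_ne_one this
  have R : ∀ r, linEl F S (G r) * linEl F S (G r) =
      ∑ j, if j < r then T r j • (linEl F S (G j) * linEl F S (G r)) else 0 := by
    intro r
    have := congrArg e (rel_zero F T r)
    rw [map_mul, map_sum] at this
    simp only [hG]
    rw [this]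
    refine Finset.sum_congr rfl fun j _ => ?_
    split_ifs
    · rw [map_smul, map_mul]
    · rw [map_zero]
  have R0 := R 0
  have R1 := R 1
  have R2 := R 2
  have R3 := R 3
  subst hT
  simp [Fin.sum_univ_four] at R0 R1 R2 R3
  have R0' : linEl F S (G 0) * linEl F S (G 0) = 0 := by simp [R0]
  have R1' : linEl F S (G 1) * linEl F S (G 1) = 0 := by simp [R1]
  rw [← add_mul, ← linEl_add] at R2
  have P := linEl_mul F h2 S _ _ _ R2
  have Q := linEl_mul F h2 S _ _ _ R3
  subst hS
  obtain ⟨x2, x3, x01⟩ := sq_zero_coords F h2 u v _ R0'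
  obtain ⟨y2, y3, y01⟩ := sq_zero_coords F h2 u v _ R1'
  have dd : (Matrix.of G).det = (G 0 0 * G 1 1 - G 0 1 * G 1 0) *
      (G 2 2 * G 3 3 - G 2 3 * G 3 2) := by
    rw [Matrix.det_succ_row_zero]
    simp [Fin.sum_univ_succ, Matrix.det_fin_three, Fin.succAbove, x2, x3, y2, y3]
    ring
  rw [dd] at hdet
  have hd1 := left_ne_zero_of_mul hdet
  have hd2 := right_ne_zero_of_mul hdet
  have hab : G 0 0 + G 1 0 ≠ 0 ∧ G 0 1 + G 1 1 ≠ 0 := by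
    rcases mul_eq_zero.1 x01 with h | h <;> rcases mul_eq_zero.1 y01 with h' | h' <;>
      simp_all
  have p01 := P 0 1 (by decide)
  have p02 := P 0 2 (by decide)
  have p12 := P 1 2 (by decide)
  have p03 := P 0 3 (by decide)
  have p13 := P 1 3 (by decide)
  have p23 := P 2 3 (by decide)
  have q01 := Q 0 1 (by decide)
  have q02 := Q 0 2 (by decide)
  have q12 := Q 1 2 (by decide)
  have q03 := Q 0 3 (by decide)
  have q13 := Q 1 3 (by decide)
  have q23 := Q 2 3 (by decide)
  simp [x2, x3, y2, y3, -mul_eq_mul_right_iff, -mul_eq_mul_left_iff] at p01 p02 p12 p03 p13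
  simp only [Pi.add_apply, x2, x3, y2, y3] at p23
  simp [-mul_eq_mul_right_iff, -mul_eq_mul_left_iff] at q01 q02 q12 q03 q13 q23
  refine final_coords F h2 u v _ _ hab.1 hab.2 (G 2 0) (G 2 1) (G 2 2) (G 2 3)
    (G 3 0) (G 3 1) (G 3 2) (G 3 3) hd2 ?_ ?_ ?_ ?_ ?_ ?_ ?_ ?_ ?_ ?_ ?_ ?_
  · linear_combination p01
  · linear_combination p02
  · linear_combination p12
  · linear_combination p03
  · linear_combination p13
  · simp at p23
    linear_combination p23
  · linear_combination q01
  · linear_combination q02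
  · linear_combination q12
  · linear_combination q03
  · linear_combination q13
  · linear_combination q23
end
end

section
/- Let F be a field of characteristic ≠ 2 and let T and S be the 4×4 strictly lower triangular matrices over F with rows T: (0,0,0,0), (0,0,0,0), (1,1,0,0), (0,0,1,0) and S: (0,0,0,0), (0,0,0,0), (1,1,0,0), (u,v,1,0). Then A(T) ≅ A(S) as graded algebras if and only if either (v ≠ −1/2 and u = −v/(2v+1)) or (u ≠ −1/2 and v = −u/(2u+1)). -/
open MvPolynomial

noncomputable section

variable (F : Type) [Field F]

/-- The bilinear form giving the coefficient of `X i * X j` (`i < j`) of a product of two linear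
forms in the quotient (`s` is the matrix entry `S j i`). -/
def BB (s a b c d : F) : F := a * d + b * c + s * b * d

abbrev SM (u v : F) : Matrix (Fin 4) (Fin 4) F := !![(0:F),0,0,0; 0,0,0,0; 1,1,0,0; u,v,1,0]

abbrev ev0 : MvPolynomial (Fin 4) F →+* F := eval (fun _ => (0:F))

lemma mem_ideal (u v : F) (p : MvPolynomial (Fin 4) F)
    (hp : p ∈ Ideal.span (relSet F (SM F u v))) :
    ev0 F p = 0 ∧ (∀ i, ev0 F (pderiv i p) = 0) ∧
    ∀ i j, i < j → 2 * ev0 F (pderiv i (pderiv j p))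
      + SM F u v j i * ev0 F (pderiv j (pderiv j p)) = 0 := by
  induction hp using Submodule.span_induction with
  | zero => simp
  | add x y _ _ hx hy =>
    obtain ⟨a1, a2, a3⟩ := hx
    obtain ⟨b1, b2, b3⟩ := hy
    refine ⟨by simp only [map_add, a1, b1, add_zero],
      fun i => by simp only [map_add, a2, b2, add_zero], fun i j h => ?_⟩
    have := a3 i j h
    have := b3 i j h
    simp only [map_add]
    linear_combination a3 i j h + b3 i j h
  | smul q x _ hx =>
    obtain ⟨a1, a2, a3⟩ := hx
    refine ⟨by simp only [smul_eq_mul, map_mul, a1, mul_zero],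
      fun i => by simp only [smul_eq_mul, map_mul, map_add, Derivation.leibniz, a1, a2]; ring,
      fun i j h => ?_⟩
    have := a3 i j h
    simp only [smul_eq_mul, map_mul, map_add, Derivation.leibniz, a1, a2]
    linear_combination ev0 F q * a3 i j h
  | mem x h =>
    obtain ⟨k, rfl⟩ := h
    have e0 : (Finset.univ.filter (fun j : Fin 4 => j < 0)) = ∅ := by decide
    have e1 : (Finset.univ.filter (fun j : Fin 4 => j < 1)) = {0} := by decide
    have e2 : (Finset.univ.filter (fun j : Fin 4 => j < 2)) = {0,1} := by decide
    have e3 : (Finset.univ.filter (fun j : Fin 4 => j < 3)) = {0,1,2} := by decide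
    refine ⟨?_, ?_, ?_⟩
    · fin_cases k <;> simp [e0,e1,e2,e3]
    · intro i
      fin_cases k <;> simp [e0,e1,e2,e3, Derivation.leibniz, pow_two]
    · intro i j h
      fin_cases k <;> fin_cases i <;> fin_cases j <;> first
        | (exfalso; revert h; decide)
        | (simp [e2,e3, Finset.filter_eq', Derivation.leibniz, pow_two, pderiv_X, Pi.single_apply] <;> ring)

/-- linear form -/
def lin (z : Fin 4 → F) : MvPolynomial (Fin 4) F := ∑ k, C (z k) * X k

lemma d1_lin (z : Fin 4 → F) (i : Fin 4) : pderiv i (lin F z) = C (z i) := by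
  simp [lin, Derivation.leibniz, pderiv_X, Pi.single_apply]

lemma ev_lin (z : Fin 4 → F) : ev0 F (lin F z) = 0 := by
  simp [lin]

lemma d2_lin (z w : Fin 4 → F) (i j : Fin 4) :
    ev0 F (pderiv i (pderiv j (lin F z * lin F w))) = z i * w j + z j * w i := by
  simp [Derivation.leibniz, d1_lin]; ring

abbrev BV (u v : F) (i j : Fin 4) (z w : Fin 4 → F) : F :=
  BB F (SM F u v j i) (z i) (z j) (w i) (w j)

lemma quad (h2 : (2 : F) ≠ 0) (u v : F) (z w z' w' : Fin 4 → F)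
    (h : lin F z * lin F w - lin F z' * lin F w' ∈ Ideal.span (relSet F (SM F u v)))
    (i j : Fin 4) (hij : i < j) : BV F u v i j z w = BV F u v i j z' w' := by
  have := (mem_ideal F u v _ h).2.2 i j hij
  simp only [map_sub, d2_lin] at this
  apply mul_left_cancel₀ h2
  simp only [BV, BB]
  linear_combination this

lemma span_lin (u v : F) (x : NTAlg F (SM F u v))
    (hx : x ∈ Submodule.span F (Set.range (NTgen F (SM F u v)))) :
    ∃ z : Fin 4 → F, x = Ideal.Quotient.mk _ (lin F z) := by
  rw [Submodule.mem_span_range_iff_exists_fun] at hx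
  obtain ⟨c, rfl⟩ := hx
  refine ⟨c, ?_⟩
  simp only [lin, map_sum, NTgen]
  refine Finset.sum_congr rfl fun k _ => ?_
  rw [← smul_eq_C_mul]
  rfl

lemma sqzero (h2 : (2 : F) ≠ 0) (u v : F) (z : Fin 4 → F)
    (h : ∀ i j, i < j → BV F u v i j z z = 0) : z 3 = 0 ∧ z 2 = 0 ∧ z 0 * z 1 = 0 := by
  have h01 := h 0 1 (by decide)
  have h02 := h 0 2 (by decide)
  have h12 := h 1 2 (by decide)
  have h03 := h 0 3 (by decide)
  have h13 := h 1 3 (by decide)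
  have h23 := h 2 3 (by decide)
  simp [BV, BB] at h01 h02 h12 h03 h13 h23
  generalize z 0 = a at *
  generalize z 1 = b at *
  generalize z 2 = c at *
  generalize z 3 = d at *
  have hab : a * b = 0 := by grind
  have hd : d = 0 := by
    by_contra hd
    have : 2 * c = - d := by grind
    have hc : c ≠ 0 := by grind
    have : 2 * a = -c := by grind
    have : 2 * b = -c := by grind
    grind
  refine ⟨hd, ?_, hab⟩
  by_contra hc
  have : 2 * a = -c := by grind
  have : 2 * b = -c := by grind
  grind

/-- Core computation, unswapped case. -/
lemma core (h2 : (2 : F) ≠ 0) (u v α β : F) (hα : α ≠ 0) (hβ : β ≠ 0) (z w : Fin 4 → F)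
    (hz : ∀ i j, i < j → BV F u v i j z z = BV F u v i j z ![α, β, 0, 0])
    (hw : ∀ i j, i < j → BV F u v i j w w = BV F u v i j w z)
    (hi : z 2 * w 3 - z 3 * w 2 ≠ 0) : 2 * u * v + u + v = 0 := by
  obtain ⟨y3, hy3⟩ : ∃ y, y = z 3 := ⟨_, rfl⟩
  obtain ⟨y2, hy2⟩ : ∃ y, y = z 2 + z 3 / 2 := ⟨_, rfl⟩
  obtain ⟨y0, hy0⟩ : ∃ y, y = z 0 + u * z 3 / 2 + (z 2 + z 3 / 2) / 2 - α / 2 := ⟨_, rfl⟩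
  obtain ⟨y1, hy1⟩ : ∃ y, y = z 1 + v * z 3 / 2 + (z 2 + z 3 / 2) / 2 - β / 2 := ⟨_, rfl⟩
  obtain ⟨x3, hx3⟩ : ∃ y, y = w 3 - z 3 / 2 := ⟨_, rfl⟩
  obtain ⟨x2, hx2⟩ : ∃ y, y = w 2 + w 3 / 2 - y2 / 2 := ⟨_, rfl⟩
  obtain ⟨x0, hx0⟩ : ∃ y, y = w 0 + u * w 3 / 2 + (w 2 + w 3 / 2) / 2
    - (y0 + α / 2) / 2 := ⟨_, rfl⟩
  obtain ⟨x1, hx1⟩ : ∃ y, y = w 1 + v * w 3 / 2 + (w 2 + w 3 / 2) / 2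
    - (y1 + β / 2) / 2 := ⟨_, rfl⟩
  have z3 : z 3 = y3 := hy3.symm
  have z2 : z 2 = y2 - y3 / 2 := by rw [hy2, z3]; ring
  have z0 : z 0 = y0 - u * y3 / 2 - y2 / 2 + α / 2 := by rw [hy0, hy2, z3]; ring
  have z1 : z 1 = y1 - v * y3 / 2 - y2 / 2 + β / 2 := by rw [hy1, hy2, z3]; ring
  have w3 : w 3 = x3 + y3 / 2 := by rw [hx3, z3]; ring
  have w2 : w 2 = x2 + y2 / 2 - (x3 + y3 / 2) / 2 := by rw [hx2, w3]; ring
  have w0 : w 0 = x0 - u * (x3 + y3 / 2) / 2 - (x2 + y2 / 2) / 2 + (y0 + α / 2) / 2 := by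
    rw [hx0, w2, w3]; ring
  have w1 : w 1 = x1 - v * (x3 + y3 / 2) / 2 - (x2 + y2 / 2) / 2 + (y1 + β / 2) / 2 := by
    rw [hx1, w2, w3]; ring
  have h01 := hz 0 1 (by decide)
  have h02 := hz 0 2 (by decide)
  have h12 := hz 1 2 (by decide)
  have h03 := hz 0 3 (by decide)
  have h13 := hz 1 3 (by decide)
  have h23 := hz 2 3 (by decide)
  have k01 := hw 0 1 (by decide)
  have k02 := hw 0 2 (by decide)
  have k12 := hw 1 2 (by decide)
  have k03 := hw 0 3 (by decide)
  have k13 := hw 1 3 (by decide)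
  have k23 := hw 2 3 (by decide)
  simp [BV, BB, z0, z1, z2, z3, w0, w1, w2, w3] at h01 h02 h12 h03 h13 h23 k01 k02 k12 k03 k13 k23
  rw [z2, z3, w2, w3] at hi
  clear hy0 hy1 hy2 hy3 hx0 hx1 hx2 hx3 z0 z1 z2 z3 w0 w1 w2 w3 hz hw
  have hi' : y2 * x3 - y3 * x2 ≠ 0 := by
    intro h; apply hi; field_simp; linear_combination 4 * h
  have e03 : y0 * y3 = 0 := by grind
  have e13 : y1 * y3 = 0 := by grind
  have e23 : y2 * y3 = 0 := by grind
  by_cases hy : y3 = 0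
  · subst hy
    have hy2 : y2 ≠ 0 := by rintro rfl; simp at hi'
    have hx3 : x3 ≠ 0 := by rintro rfl; simp at hi'
    have e02 : y0 * y2 = 0 := by grind
    have e12 : y1 * y2 = 0 := by grind
    have y00 : y0 = 0 := by grind
    have y10 : y1 = 0 := by grind
    subst y00 y10
    have e01 : y2 ^ 2 = α * β := by grind
    have f0 : x0 * x3 = 0 := by grind
    have f1 : x1 * x3 = 0 := by grind
    have f2 : x2 * x3 = 0 := by grind
    have x00 : x0 = 0 := by grind
    have x10 : x1 = 0 := by grind
    have x20 : x2 = 0 := by grind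
    subst x00 x10 x20
    have g0 : x3 ^ 2 * (2 * u + 1) = y2 * α := by grind
    have g1 : x3 ^ 2 * (2 * v + 1) = y2 * β := by grind
    have g01 : x3 ^ 2 * (1 + (2 * u + 1) * (2 * v + 1)) = 2 * y2 ^ 2 := by grind
    have m : x3 ^ 4 * ((2 * u + 1) * (2 * v + 1)) = y2 ^ 4 := by
      linear_combination x3 ^ 2 * (2 * v + 1) * g0 + y2 * α * g1 - y2 ^ 2 * e01
    have n : (x3 ^ 2 - y2 ^ 2) ^ 2 = 0 := by linear_combination x3 ^ 2 * g01 - m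
    have n' : x3 ^ 2 = y2 ^ 2 := sub_eq_zero.mp (pow_eq_zero_iff (two_ne_zero) |>.mp n)
    have h3 : 2 * x3 ^ 2 * (2 * u * v + u + v) = 0 := by
      linear_combination g01 - 2 * n'
    have h4 : 2 * x3 ^ 2 ≠ 0 := mul_ne_zero h2 (pow_ne_zero _ hx3)
    exact (mul_eq_zero.mp h3).resolve_left h4
  · exfalso
    have y00 : y0 = 0 := by grind
    have y10 : y1 = 0 := by grind
    have y20 : y2 = 0 := by grind
    subst y00 y10 y20
    have hx2 : x2 ≠ 0 := by rintro rfl; simp at hi'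
    have e0 : y3 ^ 2 * (2 * u + 1) = 0 := by grind
    have e1 : y3 ^ 2 * (2 * v + 1) = 0 := by grind
    have f0 : 2 * u + 1 = 0 := by grind
    have f1 : 2 * v + 1 = 0 := by grind
    have f23 : x2 * x3 = 0 := by grind
    have x30 : x3 = 0 := by grind
    subst x30
    have : y3 * α = 0 := by grind
    grind


/-- The transposition exchanging the first two coordinates. -/
def sw (z : Fin 4 → F) : Fin 4 → F := ![z 1, z 0, z 2, z 3]

lemma sw_eq (u v : F) (z w z' w' : Fin 4 → F)
    (h : ∀ i j, i < j → BV F u v i j z w = BV F u v i j z' w') :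
    ∀ i j, i < j → BV F v u i j (sw F z) (sw F w) = BV F v u i j (sw F z') (sw F w') := by
  have h01 := h 0 1 (by decide)
  have h02 := h 0 2 (by decide)
  have h12 := h 1 2 (by decide)
  have h03 := h 0 3 (by decide)
  have h13 := h 1 3 (by decide)
  have h23 := h 2 3 (by decide)
  simp [BV, BB] at h01 h02 h12 h03 h13 h23
  intro i j hij
  fin_cases i <;> fin_cases j <;> first
    | (exfalso; revert hij; decide)
    | (simp [BV, BB, sw]; first | assumption | linear_combination h01)

lemma alg (h2 : (2 : F) ≠ 0) (u v : F) (g : Fin 4 → Fin 4 → F)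
    (h0 : ∀ i j, i < j → BV F u v i j (g 0) (g 0) = 0)
    (h1 : ∀ i j, i < j → BV F u v i j (g 1) (g 1) = 0)
    (hz : ∀ i j, i < j → BV F u v i j (g 2) (g 2) = BV F u v i j (g 2) (g 0 + g 1))
    (hw : ∀ i j, i < j → BV F u v i j (g 3) (g 3) = BV F u v i j (g 3) (g 2))
    (hi : Matrix.det (Matrix.of g) ≠ 0) : 2 * u * v + u + v = 0 := by
  obtain ⟨a3, a2, a01⟩ := sqzero F h2 u v _ h0
  obtain ⟨b3, b2, b01⟩ := sqzero F h2 u v _ h1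
  have hdet : (g 0 0 * g 1 1 - g 0 1 * g 1 0) * (g 2 2 * g 3 3 - g 2 3 * g 3 2) ≠ 0 := by
    intro h
    apply hi
    simp [Matrix.det_succ_row_zero, Fin.sum_univ_succ, Fin.succAbove]
    simp [a3, a2, b3, b2]
    linear_combination h
  have hd1 := left_ne_zero_of_mul hdet
  have hd2 := right_ne_zero_of_mul hdet
  by_cases hc : g 0 0 = 0
  · have p1 : g 0 1 ≠ 0 := by intro h; simp [h, hc] at hd1
    have p2 : g 1 0 ≠ 0 := by intro h; simp [h, hc] at hd1
    have p3 : g 1 1 = 0 := by grind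
    have e : sw F (g 0 + g 1) = ![g 0 1, g 1 0, 0, 0] := by
      ext i; fin_cases i <;> simp [sw, *]
    have hz' := sw_eq F u v _ _ _ _ hz
    rw [e] at hz'
    have := core F h2 v u _ _ p1 p2 (sw F (g 2)) (sw F (g 3)) hz' (sw_eq F u v _ _ _ _ hw) hd2
    linear_combination this
  · have p1 : g 0 1 = 0 := by grind
    have p2 : g 1 1 ≠ 0 := by intro h; simp [h, p1] at hd1
    have p3 : g 1 0 = 0 := by grind
    have e : g 0 + g 1 = ![g 0 0, g 1 1, 0, 0] := by
      ext i; fin_cases i <;> simp [*]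
    rw [e] at hz
    exact core F h2 u v _ _ hc p2 (g 2) (g 3) hz hw hd2

lemma rels (u v : F) :
    (NTgen F (SM F u v) 0) ^ 2 = 0 ∧ (NTgen F (SM F u v) 1) ^ 2 = 0 ∧
    (NTgen F (SM F u v) 2) ^ 2 = (NTgen F (SM F u v) 0 + NTgen F (SM F u v) 1) *
      NTgen F (SM F u v) 2 ∧
    (NTgen F (SM F u v) 3) ^ 2 = (u • NTgen F (SM F u v) 0 + v • NTgen F (SM F u v) 1 +
      NTgen F (SM F u v) 2) * NTgen F (SM F u v) 3 := by
  have key : ∀ i : Fin 4, (Ideal.Quotient.mk (Ideal.span (relSet F (SM F u v))))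
      (X i ^ 2 - ∑ j ∈ Finset.univ.filter (fun j => j < i),
        C (SM F u v i j) * X j * X i) = 0 := fun i =>
    Ideal.Quotient.eq_zero_iff_mem.mpr (Ideal.subset_span ⟨i, rfl⟩)
  have e0 : (Finset.univ.filter (fun j : Fin 4 => j < 0)) = ∅ := by decide
  have e1 : (Finset.univ.filter (fun j : Fin 4 => j < 1)) = {0} := by decide
  have e2 : (Finset.univ.filter (fun j : Fin 4 => j < 2)) = {0,1} := by decide
  have e3 : (Finset.univ.filter (fun j : Fin 4 => j < 3)) = {0,1,2} := by decide
  have hs : ∀ (c : F) (i : Fin 4), c • NTgen F (SM F u v) i =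
      Ideal.Quotient.mk (Ideal.span (relSet F (SM F u v))) (C c) * NTgen F (SM F u v) i := by
    intro c i
    rw [NTgen, ← map_mul, ← smul_eq_C_mul]; rfl
  have k0 := key 0
  have k1 := key 1
  have k2 := key 2
  have k3 := key 3
  rw [e0] at k0
  rw [e1] at k1
  rw [e2] at k2
  rw [e3] at k3
  rw [hs, hs]
  simp at k0 k1 k2 k3
  simp only [NTgen]
  refine ⟨by linear_combination k0, by linear_combination k1, by linear_combination k2,
    by linear_combination k3⟩

lemma forward_s8 (h2 : (2 : F) ≠ 0) (u v : F) (h : NTIso F (SM F 0 0) (SM F u v)) :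
    2 * u * v + u + v = 0 := by
  obtain ⟨e, he, -⟩ := h
  choose g hg using fun j => span_lin F u v _ (he j)
  obtain ⟨r0, r1, r2, r3⟩ := rels F 0 0
  have add_lin : ∀ z w, lin F (z + w) = lin F z + lin F w := by
    intro z w; simp [lin, Finset.sum_add_distrib, add_mul]
  have step : ∀ z w z' w', (Ideal.Quotient.mk (Ideal.span (relSet F (SM F u v)))) (lin F z)
      * Ideal.Quotient.mk _ (lin F w) = Ideal.Quotient.mk _ (lin F z') *
        Ideal.Quotient.mk _ (lin F w') →
      ∀ i j, i < j → BV F u v i j z w = BV F u v i j z' w' := by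
    intro z w z' w' h
    rw [← map_mul, ← map_mul, Ideal.Quotient.eq] at h
    exact quad F h2 u v _ _ _ _ h
  have lin0 : lin F 0 = 0 := by simp [lin]
  have B0 : ∀ i j, BV F u v i j 0 0 = 0 := by intro i j; simp [BV, BB]
  apply alg F h2 u v g
  · intro i j hij
    rw [← B0 i j]
    refine step _ _ _ _ ?_ i j hij
    rw [← hg, lin0, map_zero, mul_zero, ← map_mul, ← pow_two, r0, map_zero]
  · intro i j hij
    rw [← B0 i j]
    refine step _ _ _ _ ?_ i j hij
    rw [← hg, lin0, map_zero, mul_zero, ← map_mul, ← pow_two, r1, map_zero]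
  · refine step _ _ _ _ ?_
    rw [add_lin, map_add, ← hg, ← hg, ← hg, ← map_mul, ← map_add, ← map_mul, ← pow_two, r2, mul_comm]
  · refine step _ _ _ _ ?_
    rw [← hg, ← hg, ← map_mul, ← map_mul, ← pow_two, r3, zero_smul, zero_smul, zero_add, zero_add,
      mul_comm]
  · intro hdet
    obtain ⟨c, hc, hc'⟩ := Matrix.exists_vecMul_eq_zero_iff.mpr hdet
    apply hc
    have hs : ∀ (c : F) (i : Fin 4), c • NTgen F (SM F 0 0) i =
        Ideal.Quotient.mk (Ideal.span (relSet F (SM F 0 0))) (C c * X i) := by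
      intro c i
      rw [NTgen, ← smul_eq_C_mul]; rfl
    have hs' : ∀ (c : F) (p : MvPolynomial (Fin 4) F),
        c • Ideal.Quotient.mk (Ideal.span (relSet F (SM F u v))) p =
        Ideal.Quotient.mk (Ideal.span (relSet F (SM F u v))) (C c * p) := by
      intro c i
      rw [← smul_eq_C_mul]; rfl
    have h0 : e (∑ i, c i • NTgen F (SM F 0 0) i) = 0 := by
      rw [map_sum]
      simp only [map_smul, hg, hs']
      rw [← map_sum]
      have : ∑ i, C (c i) * lin F (g i) = lin F (Matrix.vecMul c (Matrix.of g)) := by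
        simp only [lin, Matrix.vecMul, dotProduct, Finset.mul_sum, map_sum, Finset.sum_mul]
        rw [Finset.sum_comm]
        simp [mul_assoc]
      rw [this, hc', lin0, map_zero]
    rw [map_eq_zero_iff e e.injective] at h0
    simp only [hs] at h0
    rw [← map_sum, Ideal.Quotient.eq_zero_iff_mem] at h0
    have := (mem_ideal F 0 0 (lin F c) h0).2.1
    ext i
    simpa [d1_lin] using this i

/-- images of generators under the explicit isomorphism -/
def img (s t a b u v : F) : Fin 4 → NTAlg F (SM F s t) :=
  ![a • NTgen F (SM F s t) 0, b • NTgen F (SM F s t) 1,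
    NTgen F (SM F s t) 2 + u • NTgen F (SM F s t) 0 + v • NTgen F (SM F s t) 1,
    NTgen F (SM F s t) 3]

lemma smul_mk (s t c : F) (x : NTAlg F (SM F s t)) :
    c • x = Ideal.Quotient.mk (Ideal.span (relSet F (SM F s t))) (C c) * x := by
  obtain ⟨p, rfl⟩ := Ideal.Quotient.mk_surjective x
  rw [← map_mul, ← smul_eq_C_mul]; rfl

lemma hom_exists (u v s t a b c d : F)
    (hcd : a * d + b * c = 2 * c * d) (ha : a = 2 * c + 1) (hb : b = 2 * d + 1)
    (hs : u * a + c = s) (ht : v * b + d = t) :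
    ∃ f : NTAlg F (SM F u v) →ₐ[F] NTAlg F (SM F s t),
      ∀ i, f (NTgen F (SM F u v) i) = img F s t a b c d i := by
  have hle : Ideal.span (relSet F (SM F u v)) ≤
      RingHom.ker (aeval (R := F) (img F s t a b c d)) := by
    rw [Ideal.span_le]
    rintro _ ⟨i, rfl⟩
    have e2 : (Finset.univ.filter (fun j : Fin 4 => j < 2)) = {0,1} := by decide
    have e3 : (Finset.univ.filter (fun j : Fin 4 => j < 3)) = {0,1,2} := by decide
    obtain ⟨r0, r1, r2, r3⟩ := rels F s t
    obtain ⟨κ, hκ⟩ : ∃ κ : F →+* NTAlg F (SM F s t), ∀ c : F, ∀ x : NTAlg F (SM F s t),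
        c • x = κ c * x := ⟨(Ideal.Quotient.mk _).comp C, smul_mk F s t⟩
    have hA : ∀ c : F, algebraMap F (NTAlg F (SM F s t)) c = κ c := by
      intro c; rw [Algebra.algebraMap_eq_smul_one, hκ, mul_one]
    have hcd' := congrArg κ hcd
    have ha' := congrArg κ ha
    have hb' := congrArg κ hb
    have hs' := congrArg κ hs
    have ht' := congrArg κ ht
    rw [SetLike.mem_coe, RingHom.mem_ker]
    rw [hκ, hκ] at r3
    simp only [map_add, map_mul, map_one, map_ofNat] at hcd' ha' hb' hs' ht'
    have i0 : img F s t a b c d 0 = κ a * NTgen F (SM F s t) 0 := hκ _ _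
    have i1 : img F s t a b c d 1 = κ b * NTgen F (SM F s t) 1 := hκ _ _
    have i2 : img F s t a b c d 2 = NTgen F (SM F s t) 2 + κ c * NTgen F (SM F s t) 0
      + κ d * NTgen F (SM F s t) 1 := by rw [← hκ, ← hκ]; rfl
    have i3 : img F s t a b c d 3 = NTgen F (SM F s t) 3 := rfl
    generalize NTgen F (SM F s t) 0 = x0 at *
    generalize NTgen F (SM F s t) 1 = x1 at *
    generalize NTgen F (SM F s t) 2 = x2 at *
    generalize NTgen F (SM F s t) 3 = x3 at *
    rw [map_sub, map_sum]
    simp only [map_mul, map_pow, aeval_X, aeval_C, hA]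
    fin_cases i
    · simp [i0]
      linear_combination (κ a)^2 * r0
    · simp [i1, Finset.filter_eq']
      linear_combination (κ b)^2 * r1
    · simp [e2, i0, i1, i2]
      linear_combination r2 + (κ c ^ 2 - κ a * κ c) * r0 + (κ d ^ 2 - κ b * κ d) * r1
        - x0 * x1 * hcd' - x0 * x2 * ha' - x1 * x2 * hb'
    · simp [e3, i0, i1, i2, i3]
      linear_combination r3 - x0 * x3 * hs' - x1 * x3 * ht'
  refine ⟨Ideal.Quotient.liftₐ _ (aeval (img F s t a b c d)) (fun p hp => hle hp), ?_⟩
  intro i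
  exact aeval_X (img F s t a b c d) i

lemma backward_s8 (u v : F) (h : 2 * u * v + u + v = 0) : NTIso F (SM F 0 0) (SM F u v) := by
  obtain ⟨f, hf⟩ := hom_exists F 0 0 u v (2*u+1) (2*v+1) u v (by linear_combination h) rfl rfl
    (by ring) (by ring)
  obtain ⟨f', hf'⟩ := hom_exists F u v 0 0 (2*v+1) (2*u+1) v u (by linear_combination h) rfl rfl
    (by linear_combination h) (by linear_combination h)
  have hab : (2*u+1) * (2*v+1) = 1 := by linear_combination 2 * h
  have hba : (2*v+1) * (2*u+1) = 1 := by linear_combination 2 * h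
  have hva : v * (2*u+1) = -u := by linear_combination h
  have hub : u * (2*v+1) = -v := by linear_combination h
  have hmem : ∀ (s t a b c d : F) (i : Fin 4), img F s t a b c d i ∈
      Submodule.span F (Set.range (NTgen F (SM F s t))) := by
    intro s t a b c d i
    have hg : ∀ i, NTgen F (SM F s t) i ∈ Submodule.span F (Set.range (NTgen F (SM F s t))) :=
      fun i => Submodule.subset_span ⟨i, rfl⟩
    fin_cases i
    · exact Submodule.smul_mem _ _ (hg 0)
    · exact Submodule.smul_mem _ _ (hg 1)
    · exact Submodule.add_mem _ (Submodule.add_mem _ (hg 2) (Submodule.smul_mem _ _ (hg 0)))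
        (Submodule.smul_mem _ _ (hg 1))
    · exact hg 3
  have id1 : f.comp f' = AlgHom.id F _ := by
    apply Ideal.Quotient.algHom_ext
    apply MvPolynomial.algHom_ext
    intro i
    change f (f' (NTgen F (SM F u v) i)) = NTgen F (SM F u v) i
    rw [hf']
    fin_cases i
    · simp [img, hf, smul_smul, hba]
    · simp [img, hf, smul_smul, hab]
    · simp [img, hf, smul_smul, hva, hub]
      try abel
    · simp [img, hf]
  have id2 : f'.comp f = AlgHom.id F _ := by
    apply Ideal.Quotient.algHom_ext
    apply MvPolynomial.algHom_ext
    intro i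
    change f' (f (NTgen F (SM F 0 0) i)) = NTgen F (SM F 0 0) i
    rw [hf]
    fin_cases i
    · simp [img, hf', smul_smul, hab]
    · simp [img, hf', smul_smul, hba]
    · simp [img, hf', smul_smul, hva, hub]
      try abel
    · simp [img, hf']
  refine ⟨AlgEquiv.ofAlgHom f f' id1 id2, ?_, ?_⟩
  · intro j
    change f _ ∈ _
    rw [hf]; exact hmem _ _ _ _ _ _ _
  · intro j
    change f' _ ∈ _
    rw [hf']; exact hmem _ _ _ _ _ _ _

/-- Full characterization: `A(T) ≅ A(S)` iff `u = -v/(2v+1)` (with `v ≠ -1/2`)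
or `v = -u/(2u+1)` (with `u ≠ -1/2`). -/
theorem stmt8 (h2 : (2 : F) ≠ 0) (u v : F) :
    NTIso F
        !![(0:F),0,0,0; 0,0,0,0; 1,1,0,0; 0,0,1,0]
        !![(0:F),0,0,0; 0,0,0,0; 1,1,0,0; u,v,1,0] ↔
      ((v ≠ -(1/2) ∧ u = -v / (2*v + 1)) ∨ (u ≠ -(1/2) ∧ v = -u / (2*u + 1))) := by
  have key : NTIso F (SM F 0 0) (SM F u v) ↔ 2 * u * v + u + v = 0 :=
    ⟨forward_s8 F h2 u v, backward_s8 F u v⟩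
  refine key.trans ?_
  have aux : ∀ x : F, x ≠ -(1/2) ↔ 2 * x + 1 ≠ 0 := by
    intro x
    refine not_congr ⟨?_, ?_⟩
    · rintro rfl; field_simp; ring
    · intro h; field_simp; linear_combination h
  rw [aux, aux]
  constructor
  · intro h
    have hv : 2 * v + 1 ≠ 0 := by
      intro h0
      have : (1 : F) = 0 := by linear_combination (2 * u + 1) * h0 - 2 * h
      exact one_ne_zero this
    exact Or.inl ⟨hv, by rw [eq_div_iff hv]; linear_combination h⟩
  · rintro (⟨h1, h⟩ | ⟨h1, h⟩)
    · rw [eq_div_iff h1] at h; linear_combination h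
    · rw [eq_div_iff h1] at h; linear_combination h
end
end

section
/- Let F be a field of characteristic ≠ 2 and n ≥ 4. Then the number N_n of isomorphism classes of graded algebras A(T) over strictly lower triangular n×n matrices T is strictly greater than the Catalan number C_{n−1}. -/
open MvPolynomial

noncomputable section

variable (F : Type) [Field F]

section Helpers

variable {K : Type} [Field K] {n : ℕ}

/-- standard basis vector -/
def ee (i : Fin n) : Fin n → K := Pi.single i 1

lemma ee_same (i : Fin n) : (ee i : Fin n → K) i = 1 := by simp [ee]

lemma ee_ne {i j : Fin n} (h : j ≠ i) : (ee i : Fin n → K) j = 0 := by simp [ee, h]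

lemma sum_ee (v : Fin n → K) : v = ∑ i, v i • ee i := by
  ext j
  simp [ee, Finset.sum_apply, Pi.single_apply]

lemma bil_expand (β : LinearMap.BilinForm K (Fin n → K)) (x y : Fin n → K) :
    β x y = ∑ i, ∑ j, x i * y j * β (ee i) (ee j) := by
  conv_lhs => rw [sum_ee x, sum_ee y]
  simp only [map_sum, LinearMap.sum_apply, map_smul, LinearMap.smul_apply, smul_eq_mul]
  rw [Finset.sum_comm]
  simp only [Finset.mul_sum]
  refine Finset.sum_congr rfl fun i _ => Finset.sum_congr rfl fun j _ => by ring

/-- Compatible forms in normal form. -/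
def Bn (N : Matrix (Fin n) (Fin n) K) : Set (LinearMap.BilinForm K (Fin n → K)) :=
  {β | (∀ x y, β x y = β y x) ∧ ∀ r, β (ee r) (ee r) = β (N r) (N r)}

/-- `v` squares to zero modulo `W`. -/
def SqZ (B : Set (LinearMap.BilinForm K (Fin n → K))) (W : Submodule K (Fin n → K))
    (v : Fin n → K) : Prop :=
  ∀ β ∈ B, (∀ w ∈ W, ∀ x, β w x = 0) → β v v = 0

/-- Spaces obtained by successively adjoining vectors squaring to zero. -/
inductive Feas (B : Set (LinearMap.BilinForm K (Fin n → K))) :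
    ℕ → Submodule K (Fin n → K) → Prop
  | nil : Feas B 0 ⊥
  | cons {k W w} : Feas B k W → SqZ B W w → Feas B (k + 1) (W ⊔ Submodule.span K {w})
  | skip {k W} : Feas B k W → Feas B (k + 1) W

/-- The span of vectors that square to zero after at most `k` steps. -/
def Dk (B : Set (LinearMap.BilinForm K (Fin n → K))) (k : ℕ) : Submodule K (Fin n → K) :=
  Submodule.span K {v | ∃ W, Feas B k W ∧ SqZ B W v}

/-- Second invariant. -/
def QQ (B : Set (LinearMap.BilinForm K (Fin n → K))) : Prop :=
  ∃ W₁ W₂, W₁ ≠ W₂ ∧ Feas B 1 W₁ ∧ Feas B 1 W₂ ∧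
    Submodule.span K {v | SqZ B W₁ v} = ⊤ ∧ Submodule.span K {v | SqZ B W₂ v} = ⊤

/-- Isomorphism of systems of forms. -/
def BIso (B B' : Set (LinearMap.BilinForm K (Fin n → K))) : Prop :=
  ∃ Γ : (Fin n → K) ≃ₗ[K] (Fin n → K),
    (∀ β ∈ B', β.comp Γ.toLinearMap Γ.toLinearMap ∈ B) ∧
    (∀ β ∈ B, β.comp Γ.symm.toLinearMap Γ.symm.toLinearMap ∈ B')

lemma BIso.symm {B B' : Set (LinearMap.BilinForm K (Fin n → K))} (h : BIso B B') :
    BIso B' B := by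
  obtain ⟨Γ, h1, h2⟩ := h
  exact ⟨Γ.symm, h2, by simpa using h1⟩

lemma BIso.trans {B B' B'' : Set (LinearMap.BilinForm K (Fin n → K))} (h : BIso B B')
    (h' : BIso B' B'') : BIso B B'' := by
  obtain ⟨Γ, h1, h2⟩ := h
  obtain ⟨Δ, g1, g2⟩ := h'
  exact ⟨Γ.trans Δ, fun β hβ => h1 _ (g1 _ hβ), fun β hβ => g2 _ (h2 _ hβ)⟩

section transport
variable {B B' : Set (LinearMap.BilinForm K (Fin n → K))}
  {Γ : (Fin n → K) ≃ₗ[K] (Fin n → K)}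
  (h : ∀ β ∈ B', β.comp Γ.toLinearMap Γ.toLinearMap ∈ B)

lemma SqZ.map (h : ∀ β ∈ B', β.comp Γ.toLinearMap Γ.toLinearMap ∈ B) {W v} (hv : SqZ B W v) :
    SqZ B' (W.map Γ.toLinearMap) (Γ v) := by
  intro β hβ hW
  refine hv _ (h β hβ) ?_
  intro w hw x
  exact hW _ (Submodule.mem_map_of_mem hw) _

lemma Feas.map (h : ∀ β ∈ B', β.comp Γ.toLinearMap Γ.toLinearMap ∈ B) {k W}
    (hv : Feas B k W) : Feas B' k (W.map Γ.toLinearMap) := by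
  induction hv with
  | nil => simpa using Feas.nil
  | cons h1 h2 ih =>
    rw [Submodule.map_sup, Submodule.map_span, Set.image_singleton]
    exact Feas.cons ih (h2.map h)
  | skip h1 ih => exact Feas.skip ih

lemma Dk_map_le (h : ∀ β ∈ B', β.comp Γ.toLinearMap Γ.toLinearMap ∈ B) (k : ℕ) :
    (Dk B k).map Γ.toLinearMap ≤ Dk B' k := by
  rw [Dk, Submodule.map_span, Submodule.span_le]
  rintro _ ⟨v, ⟨W, hW, hv⟩, rfl⟩
  exact Submodule.subset_span ⟨_, hW.map h, hv.map h⟩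

lemma span_top_map (h : ∀ β ∈ B', β.comp Γ.toLinearMap Γ.toLinearMap ∈ B) {W}
    (ht : Submodule.span K {v | SqZ B W v} = ⊤) :
    Submodule.span K {v | SqZ B' (W.map Γ.toLinearMap) v} = ⊤ := by
  rw [eq_top_iff]
  have : (⊤ : Submodule K (Fin n → K)) = (⊤ : Submodule K (Fin n → K)).map Γ.toLinearMap := by
    rw [Submodule.map_top]; exact (LinearMap.range_eq_top.2 Γ.surjective).symm
  rw [this, ← ht, Submodule.map_span, Submodule.span_le]
  rintro _ ⟨v, hv, rfl⟩
  exact Submodule.subset_span (SqZ.map h hv)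

end transport

lemma BIso.finrank_le {B B' : Set (LinearMap.BilinForm K (Fin n → K))} (h : BIso B B') (k : ℕ) :
    Module.finrank K (Dk B k) ≤ Module.finrank K (Dk B' k) := by
  obtain ⟨Γ, h1, h2⟩ := h
  have := Submodule.finrank_mono (Dk_map_le h1 k)
  rwa [LinearEquiv.finrank_map_eq] at this

lemma BIso.finrank_eq {B B' : Set (LinearMap.BilinForm K (Fin n → K))} (h : BIso B B') (k : ℕ) :
    Module.finrank K (Dk B k) = Module.finrank K (Dk B' k) :=
  le_antisymm (h.finrank_le k) (h.symm.finrank_le k)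

lemma BIso.qq {B B' : Set (LinearMap.BilinForm K (Fin n → K))} (h : BIso B B') (hq : QQ B) :
    QQ B' := by
  obtain ⟨Γ, h1, h2⟩ := h
  obtain ⟨W₁, W₂, hne, f1, f2, t1, t2⟩ := hq
  refine ⟨W₁.map Γ.toLinearMap, W₂.map Γ.toLinearMap, ?_, f1.map h1, f2.map h1,
    span_top_map h1 t1, span_top_map h1 t2⟩
  intro he
  exact hne (Submodule.map_injective_of_injective Γ.injective he)

/-! ### strictly lower triangular matrices -/

lemma det_one_add {N : Matrix (Fin n) (Fin n) K} (hN : SLTM K N) : (1 + N).det = 1 := by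
  rw [Matrix.det_of_isLowerTriangular]
  · simp [hN _ _ le_rfl]
  · intro i j hij
    have : i < j := hij
    simp [hN i j this.le, this.ne]

lemma exists_form {N : Matrix (Fin n) (Fin n) K} (hN : SLTM K N) (s : Fin n → Fin n → K)
    (hs : ∀ i j, s i j = s j i) :
    ∃ β ∈ Bn N, ∀ i j, i ≠ j → β (ee i) (ee j) = s i j := by
  set A : Matrix (Fin n) (Fin n) K := fun i j => - (N i j) ^ 2 with hA
  have hA' : SLTM K A := fun i j h => by simp [hA, hN i j h]
  have hdet := det_one_add hA'
  set b : Fin n → K := fun i => ∑ j, ∑ k, if j = k then 0 else N i j * N i k * s j k with hb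
  set d := (1 + A)⁻¹.mulVec b with hd
  have hde : (1 + A).mulVec d = b := by
    rw [hd, Matrix.mulVec_mulVec, Matrix.mul_nonsing_inv _ (by simp [hdet]), Matrix.one_mulVec]
  set M : Matrix (Fin n) (Fin n) K := fun i j => if i = j then d i else s i j with hM
  have hMe : ∀ i j, Matrix.toBilin' M (ee i) (ee j) = M i j := fun i j =>
    Matrix.toBilin'_single M i j
  refine ⟨Matrix.toBilin' M, ⟨?_, ?_⟩, ?_⟩
  · intro x y
    rw [bil_expand, bil_expand _ y x, Finset.sum_comm]
    refine Finset.sum_congr rfl fun i _ => Finset.sum_congr rfl fun j _ => ?_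
    rw [hMe, hMe]
    have : M j i = M i j := by
      by_cases h : i = j
      · subst h; rfl
      · simp [hM, h, Ne.symm h, hs i j]
    rw [this]; ring
  · intro r
    rw [hMe, bil_expand]
    simp only [hMe]
    have h1 := congrFun hde r
    rw [Matrix.add_mulVec, Matrix.one_mulVec, Pi.add_apply] at h1
    have h2 : M r r = d r := by simp [hM]
    rw [h2, eq_sub_of_add_eq h1, hb]
    simp only [Matrix.mulVec, dotProduct]
    rw [← Finset.sum_sub_distrib]
    refine Finset.sum_congr rfl fun j _ => ?_
    have : - (A r j * d j) = ∑ k, if j = k then (N r j)^2 * d j else 0 := by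
      simp [hA]
    rw [sub_eq_add_neg, this, ← Finset.sum_add_distrib]
    refine Finset.sum_congr rfl fun k _ => ?_
    by_cases h : j = k
    · subst h; simp only [hM, if_true]; ring
    · simp [hM, h]
  · intro i j h
    rw [hMe]; simp [hM, h]

/-- The forms with exactly one nonzero off-diagonal pair. -/
lemma exists_test {N : Matrix (Fin n) (Fin n) K} (hN : SLTM K N) {r t : Fin n} (htr : t < r) :
    ∃ β ∈ Bn N, β (ee r) (ee t) = 1 ∧
      (∀ i j, i ≠ j → ¬ (i = r ∧ j = t) → ¬ (i = t ∧ j = r) → β (ee i) (ee j) = 0) ∧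
      ∀ i ≤ r, β (ee i) (ee i) = 0 := by
  obtain ⟨β, hβ, hs⟩ := exists_form hN
    (fun i j => if (i = r ∧ j = t) ∨ (i = t ∧ j = r) then 1 else 0)
    (by intro i j; congr 1; apply propext; tauto)
  refine ⟨β, hβ, ?_, ?_, ?_⟩
  · rw [hs _ _ htr.ne']; simp
  · intro i j hij h1 h2
    rw [hs _ _ hij]; simp [h1, h2]
  · intro i
    induction i using WellFoundedLT.induction with
    | ind i ih =>
      intro hir
      rw [hβ.2, bil_expand]
      refine Finset.sum_eq_zero fun j _ => Finset.sum_eq_zero fun k _ => ?_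
      by_cases hj : i ≤ j
      · simp [hN i j hj]
      by_cases hk : i ≤ k
      · simp [hN i k hk]
      rw [not_le] at hj hk
      by_cases hjk : j = k
      · subst hjk
        rw [ih j hj (hj.le.trans hir), mul_zero]
      · rw [hs _ _ hjk, if_neg, mul_zero]
        rintro (⟨h, -⟩ | ⟨-, h⟩)
        · exact absurd hir (not_le.2 (h ▸ hj))
        · exact absurd hir (not_le.2 (h ▸ hk))

/-- coordinate description of feasible spaces -/
structure Good_s16 (N : Matrix (Fin n) (Fin n) K) (W : Submodule K (Fin n → K))
    (J : Finset (Fin n)) : Prop where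
  mem : ∀ v, v ∈ W ↔ ∀ i, i ∉ J → v i = 0
  free : ∀ β ∈ Bn N, (∀ j ∈ J, ∀ i, i ≠ j → β (ee j) (ee i) = 0) → ∀ j ∈ J, β (ee j) (ee j) = 0

lemma Good_s16.rad {N : Matrix (Fin n) (Fin n) K} {W J} (hG : Good_s16 N W J)
    {β : LinearMap.BilinForm K (Fin n → K)} (hβ : β ∈ Bn N)
    (h : ∀ j ∈ J, ∀ i, i ≠ j → β (ee j) (ee i) = 0) : ∀ w ∈ W, ∀ x, β w x = 0 := by
  intro w hw x
  rw [bil_expand]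
  refine Finset.sum_eq_zero fun i _ => Finset.sum_eq_zero fun j _ => ?_
  by_cases hi : i ∈ J
  · by_cases hij : j = i
    · subst hij; rw [hG.free β hβ h j hi, mul_zero]
    · rw [h i hi j hij, mul_zero]
  · rw [(hG.mem w).1 hw i hi]; ring

lemma lemA_aux (h2 : (2 : K) ≠ 0) {N : Matrix (Fin n) (Fin n) K} (hN : SLTM K N) {W J}
    (hG : Good_s16 N W J) {v} (hv : SqZ (Bn N) W v) {r t : Fin n} (hr : r ∉ J) (ht : t ∉ J)
    (htr : t < r) (hvr : v r ≠ 0) (htop : ∀ i, r < i → i ∉ J → v i = 0) : v t = 0 := by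
  obtain ⟨β, hβ, h1, h3, h4⟩ := exists_test hN htr
  have hJ : ∀ j ∈ J, ∀ i, i ≠ j → β (ee j) (ee i) = 0 := by
    intro j hj i hij
    refine h3 _ _ hij.symm ?_ ?_
    · rintro ⟨rfl, -⟩; exact hr hj
    · rintro ⟨rfl, -⟩; exact ht hj
  have h0 := hv β hβ (hG.rad hβ hJ)
  have hterm : ∀ i j, v i * v j * β (ee i) (ee j) =
      (if i = r then (if j = t then v r * v t else 0) else 0)
      + (if i = t then (if j = r then v r * v t else 0) else 0) := by
    intro i j
    by_cases hij : i = j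
    · subst hij
      have hz : v i * v i * β (ee i) (ee i) = 0 := by
        by_cases hiJ : i ∈ J
        · rw [hG.free β hβ hJ i hiJ, mul_zero]
        by_cases hir : i ≤ r
        · rw [h4 i hir, mul_zero]
        · rw [htop i (not_le.1 hir) hiJ]; ring
      rw [hz]
      by_cases hir : i = r
      · subst hir; simp [htr.ne']
      · simp [hir]
    · by_cases ha : i = r ∧ j = t
      · obtain ⟨rfl, rfl⟩ := ha
        simp [h1, htr.ne']
      by_cases hb : i = t ∧ j = r
      · obtain ⟨rfl, rfl⟩ := hb
        rw [hβ.1, h1]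
        simp [htr.ne]; ring
      rw [h3 i j hij ha hb]
      have e1 : (if i = r then (if j = t then v r * v t else 0) else 0) = 0 := by
        rw [← ite_and, if_neg ha]
      have e2 : (if i = t then (if j = r then v r * v t else 0) else 0) = 0 := by
        rw [← ite_and, if_neg hb]
      rw [e1, e2]; ring
  rw [bil_expand] at h0
  simp only [hterm, Finset.sum_add_distrib] at h0
  have h5 : 2 * (v r * v t) = 0 := by
    rw [← h0, two_mul]
    congr 1
    · rw [Finset.sum_eq_single r] <;> simp +contextual
    · rw [Finset.sum_eq_single t] <;> simp +contextual
  simpa [h2, hvr] using h5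

lemma lemA (h2 : (2 : K) ≠ 0) {N : Matrix (Fin n) (Fin n) K} (hN : SLTM K N) {W J}
    (hG : Good_s16 N W J) {v} (hv : SqZ (Bn N) W v) {a b : Fin n} (ha : a ∉ J) (hb : b ∉ J)
    (hab : a ≠ b) (hva : v a ≠ 0) : v b = 0 := by
  classical
  by_contra hvb
  let S := Finset.univ.filter (fun i => i ∉ J ∧ v i ≠ 0)
  have hS : S.Nonempty := ⟨a, by simp [S, ha, hva]⟩
  have hr := S.max'_mem hS
  set r := S.max' hS with hrdef
  simp only [S, Finset.mem_filter, Finset.mem_univ, true_and] at hr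
  have htop : ∀ i, r < i → i ∉ J → v i = 0 := by
    intro i hi hiJ
    by_contra hvi
    exact absurd (S.le_max' i (by simp [S, hiJ, hvi])) (not_le.2 hi)
  have key : ∀ t, t ∉ J → t ≠ r → v t = 0 := by
    intro t ht htr
    rcases lt_or_gt_of_ne htr with h | h
    · exact lemA_aux h2 hN hG hv hr.1 ht h hr.2 htop
    · exact htop t h ht
  by_cases har : a = r
  · exact hvb (key b hb (fun h => hab (har.trans h.symm)))
  · exact hva (key a ha har)

/-- support of a row -/
def supp (v : Fin n → K) : Finset (Fin n) := by
  classical exact Finset.univ.filter (fun i => v i ≠ 0)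

lemma mem_supp (v : Fin n → K) (i : Fin n) : i ∈ supp v ↔ v i ≠ 0 := by
  classical simp [supp]

lemma bil_add_rad {N : Matrix (Fin n) (Fin n) K} {β : LinearMap.BilinForm K (Fin n → K)}
    (hβ : β ∈ Bn N) {w z : Fin n → K} (hw : ∀ x, β w x = 0) : β (w + z) (w + z) = β z z := by
  have : β z w = 0 := by rw [hβ.1, hw]
  simp [hw, this]

lemma sqz_single (h2 : (2 : K) ≠ 0) {N : Matrix (Fin n) (Fin n) K} (hN : SLTM K N) {W J}
    (hG : Good_s16 N W J) {v} (hv : SqZ (Bn N) W v) {a : Fin n} (ha : a ∉ J) (hva : v a ≠ 0) :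
    SqZ (Bn N) W (ee a) := by
  intro β hβ hW
  have h := hv β hβ hW
  have hw : v - v a • ee a ∈ W := by
    rw [hG.mem]
    intro i hi
    by_cases hia : i = a
    · subst hia; simp [ee_same]
    · simp [ee_ne hia, lemA h2 hN hG hv ha hi (Ne.symm hia) hva]
  have h' := bil_add_rad hβ (z := v a • ee a) (hW _ hw)
  rw [sub_add_cancel, h] at h'
  simpa [hva] using h'.symm

lemma sqz_ee {N : Matrix (Fin n) (Fin n) K} {W} {a : Fin n} :
    SqZ (Bn N) W (ee a) ↔ SqZ (Bn N) W (N a) := by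
  constructor
  · intro h β hβ hW; rw [← hβ.2]; exact h β hβ hW
  · intro h β hβ hW; rw [hβ.2]; exact h β hβ hW

lemma lemB (h2 : (2 : K) ≠ 0) {N : Matrix (Fin n) (Fin n) K} (hN : SLTM K N) {W J}
    (hG : Good_s16 N W J) {v} (hv : SqZ (Bn N) W v) {a : Fin n} (ha : a ∉ J) (hva : v a ≠ 0) :
    (supp (N a) \ J).card ≤ 1 := by
  have h := sqz_ee.1 (sqz_single h2 hN hG hv ha hva)
  rw [Finset.card_le_one]
  intro x hx y hy
  rw [Finset.mem_sdiff, mem_supp] at hx hy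
  by_contra hxy
  exact hy.1 (lemA h2 hN hG h hx.2 hy.2 hxy hx.1)

lemma feas_good (h2 : (2 : K) ≠ 0) {N : Matrix (Fin n) (Fin n) K} (hN : SLTM K N) {k W}
    (hF : Feas (Bn N) k W) :
    ∃ J : Finset (Fin n), Good_s16 N W J ∧ J.card ≤ k ∧ ∀ j ∈ J, (supp (N j)).card ≤ k := by
  classical
  induction hF with
  | nil =>
    refine ⟨∅, ⟨?_, ?_⟩, by simp, by simp⟩
    · intro v
      simp [funext_iff]
    · simp
  | @cons k W w hW hw ih =>
    obtain ⟨J, hG, hJ, hk⟩ := ih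
    by_cases hex : ∃ a, a ∉ J ∧ w a ≠ 0
    · obtain ⟨a, ha, hwa⟩ := hex
      have hea := sqz_single h2 hN hG hw ha hwa
      refine ⟨insert a J, ⟨?_, ?_⟩, ?_, ?_⟩
      · intro v
        rw [Submodule.mem_sup]
        constructor
        · rintro ⟨y, hy, z, hz, rfl⟩ i hi
          rw [Submodule.mem_span_singleton] at hz
          obtain ⟨c, rfl⟩ := hz
          rw [Finset.mem_insert, not_or] at hi
          simp [(hG.mem y).1 hy i hi.2, lemA h2 hN hG hw ha hi.2 (Ne.symm hi.1) hwa]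
        · intro hv
          refine ⟨v - (v a / w a) • w, ?_, (v a / w a) • w,
            Submodule.smul_mem _ _ (Submodule.mem_span_singleton_self _), by simp⟩
          rw [hG.mem]
          intro i hi
          by_cases hia : i = a
          · subst hia; simp [hwa]
          · simp [hv i (by simp [hia, hi]), lemA h2 hN hG hw ha hi (Ne.symm hia) hwa]
      · intro β hβ h j hj
        have hr := hG.rad hβ (fun j hj i hij => h j (by simp [hj]) i hij)
        rw [Finset.mem_insert] at hj
        rcases hj with rfl | hj
        · exact hea β hβ hr
        · exact hG.free β hβ (fun j hj i hij => h j (by simp [hj]) i hij) j hj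
      · rw [Finset.card_insert_of_notMem ha]; omega
      · intro j hj
        rw [Finset.mem_insert] at hj
        rcases hj with rfl | hj
        · have := lemB h2 hN hG hw ha hwa
          have h3 := Finset.card_le_card_sdiff_add_card (s := supp (N j)) (t := J)
          omega
        · exact (hk j hj).trans (Nat.le_succ _)
    · push Not at hex
      have : W ⊔ Submodule.span K {w} = W := by
        rw [sup_eq_left, Submodule.span_le, Set.singleton_subset_iff]
        exact (hG.mem w).2 hex
      rw [this]
      exact ⟨J, hG, by omega, fun j hj => (hk j hj).trans (Nat.le_succ _)⟩
  | skip hW ih =>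
    obtain ⟨J, hG, hJ, hk⟩ := ih
    exact ⟨J, hG, by omega, fun j hj => (hk j hj).trans (Nat.le_succ _)⟩

lemma sqz_card (h2 : (2 : K) ≠ 0) {N : Matrix (Fin n) (Fin n) K} (hN : SLTM K N) {k W}
    (hF : Feas (Bn N) k W) {v} (hv : SqZ (Bn N) W v) {a} (hva : v a ≠ 0) :
    (supp (N a)).card ≤ k + 1 := by
  obtain ⟨J, hG, hJ, hk⟩ := feas_good h2 hN hF
  by_cases ha : a ∈ J
  · exact (hk a ha).trans (Nat.le_succ _)
  · have := lemB h2 hN hG hv ha hva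
    have h3 := Finset.card_le_card_sdiff_add_card (s := supp (N a)) (t := J)
    omega

/-- vectors supported in `S` -/
def coordSub (S : Finset (Fin n)) : Submodule K (Fin n → K) :=
  Submodule.span K (Set.range (fun i : S => (ee i.1 : Fin n → K)))

lemma mem_coordSub (S : Finset (Fin n)) (v : Fin n → K) :
    v ∈ coordSub S ↔ ∀ i, i ∉ S → v i = 0 := by
  classical
  constructor
  · intro hv i hi
    have : coordSub (K := K) S ≤ LinearMap.ker (LinearMap.proj (R := K) (φ := fun _ : Fin n => K) i) := by
      rw [coordSub, Submodule.span_le]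
      rintro _ ⟨j, rfl⟩
      have : i ≠ j.1 := fun h => hi (h ▸ j.2)
      simp [ee_ne this]
    simpa using this hv
  · intro h
    rw [sum_ee v]
    refine Submodule.sum_mem _ fun i _ => ?_
    by_cases hi : i ∈ S
    · exact Submodule.smul_mem _ _ (Submodule.subset_span ⟨⟨i, hi⟩, rfl⟩)
    · rw [h i hi, zero_smul]; exact Submodule.zero_mem _

lemma finrank_coordSub (S : Finset (Fin n)) :
    Module.finrank K (coordSub (K := K) S) = S.card := by
  classical
  rw [coordSub, finrank_span_eq_card]
  · simp
  · have := (Pi.basisFun K (Fin n)).linearIndependent.comp (fun i : S => i.1)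
      Subtype.val_injective
    convert this using 1
    ext i j
    simp [ee]

lemma Dk_le (h2 : (2 : K) ≠ 0) {N : Matrix (Fin n) (Fin n) K} (hN : SLTM K N) (k : ℕ) :
    Dk (Bn N) k ≤ coordSub (Finset.univ.filter fun i => (supp (N i)).card ≤ k + 1) := by
  rw [Dk, Submodule.span_le]
  rintro v ⟨W, hF, hv⟩
  rw [SetLike.mem_coe, mem_coordSub]
  intro i hi
  by_contra hvi
  exact hi (by simpa using sqz_card h2 hN hF hv hvi)

/-! ### from algebras to forms -/

/-- Forms compatible with `T`. -/
def Bt (T : Matrix (Fin n) (Fin n) K) : Set (LinearMap.BilinForm K (Fin n → K)) :=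
  {β | (∀ x y, β x y = β y x) ∧ ∀ r, β (ee r) (ee r) = β (T r) (ee r)}

/-- linear polynomial -/
def lpol : (Fin n → K) →ₗ[K] MvPolynomial (Fin n) K :=
  Fintype.linearCombination K (fun i => (X i : MvPolynomial (Fin n) K))

lemma lpol_apply (v : Fin n → K) : lpol v = ∑ i, v i • (X i : MvPolynomial (Fin n) K) := by
  simp [lpol, Fintype.linearCombination_apply]

lemma lpol_ee (i : Fin n) : lpol (ee i : Fin n → K) = X i := by
  classical
  rw [lpol_apply]
  simp [ee, Pi.single_apply]

lemma pderiv_lpol (v : Fin n → K) (i : Fin n) : pderiv i (lpol v) = C (v i) := by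
  classical
  rw [lpol_apply]
  simp [pderiv_X, Pi.single_apply, smul_eq_C_mul]

lemma cc_lpol (v : Fin n → K) : constantCoeff (lpol v) = 0 := by
  rw [lpol_apply]
  simp [smul_eq_C_mul]

/-- The Hessian functional. -/
def hs (β : LinearMap.BilinForm K (Fin n → K)) (p : MvPolynomial (Fin n) K) : K :=
  ∑ i, ∑ j, β (ee i) (ee j) * constantCoeff (pderiv i (pderiv j p))

lemma hs_add (β : LinearMap.BilinForm K (Fin n → K)) (p q : MvPolynomial (Fin n) K) :
    hs β (p + q) = hs β p + hs β q := by
  simp [hs, mul_add, Finset.sum_add_distrib]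

lemma hs_sub (β : LinearMap.BilinForm K (Fin n → K)) (p q : MvPolynomial (Fin n) K) :
    hs β (p - q) = hs β p - hs β q := by
  simp [hs, mul_sub, Finset.sum_sub_distrib]

lemma hs_lpol (β : LinearMap.BilinForm K (Fin n → K)) (hβ : ∀ x y, β x y = β y x)
    (v w : Fin n → K) : hs β (lpol v * lpol w) = 2 * β v w := by
  have h1 : ∀ i j, constantCoeff (pderiv i (pderiv j (lpol v * lpol w))) = v i * w j + w i * v j := by
    intro i j
    simp [Derivation.leibniz, pderiv_lpol]
    ring
  rw [two_mul]
  nth_rewrite 2 [hβ]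
  rw [bil_expand β v w, bil_expand β w v, hs, ← Finset.sum_add_distrib]
  refine Finset.sum_congr rfl fun i _ => ?_
  rw [← Finset.sum_add_distrib]
  refine Finset.sum_congr rfl fun j _ => ?_
  rw [h1]; ring

lemma hs_mul (β : LinearMap.BilinForm K (Fin n → K)) (a p : MvPolynomial (Fin n) K)
    (h0 : constantCoeff p = 0) (h1 : ∀ i, constantCoeff (pderiv i p) = 0) :
    hs β (a * p) = constantCoeff a * hs β p := by
  rw [hs, hs, Finset.mul_sum]
  refine Finset.sum_congr rfl fun i _ => ?_
  rw [Finset.mul_sum]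
  refine Finset.sum_congr rfl fun j _ => ?_
  simp [Derivation.leibniz, h0, h1]
  ring

lemma row_sum {T : Matrix (Fin n) (Fin n) K} (hT : SLTM K T) (i : Fin n) :
    ∑ j ∈ Finset.univ.filter (fun j => j < i), C (T i j) * X j * X i
      = lpol (T i) * (X i : MvPolynomial (Fin n) K) := by
  rw [lpol_apply, Finset.sum_mul, Finset.sum_filter]
  refine Finset.sum_congr rfl fun j _ => ?_
  by_cases h : j < i
  · simp [h, smul_eq_C_mul]
  · simp [h, hT i j (not_lt.1 h)]

lemma ideal_facts {T : Matrix (Fin n) (Fin n) K} (hT : SLTM K T) {p : MvPolynomial (Fin n) K}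
    (hp : p ∈ Ideal.span (relSet K T)) :
    constantCoeff p = 0 ∧ (∀ i, constantCoeff (pderiv i p) = 0) ∧ ∀ β ∈ Bt T, hs β p = 0 := by
  induction hp using Submodule.span_induction with
  | mem x hx =>
    obtain ⟨i, rfl⟩ := hx
    rw [row_sum hT, ← lpol_ee, sq]
    refine ⟨by simp [cc_lpol], ?_, ?_⟩
    · intro j
      simp [Derivation.leibniz, cc_lpol]
    · intro β hβ
      rw [hs_sub, hs_lpol β hβ.1, hs_lpol β hβ.1, hβ.2, sub_self]
  | zero => simp [hs]
  | add x y hx hy h1 h2 =>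
    refine ⟨by simp [h1.1, h2.1], fun i => by simp [h1.2.1, h2.2.1], fun β hβ => ?_⟩
    rw [hs_add, h1.2.2 β hβ, h2.2.2 β hβ, add_zero]
  | smul a x hx h =>
    refine ⟨by simp [h.1], fun i => by simp [Derivation.leibniz, h.1, h.2.1], fun β hβ => ?_⟩
    rw [smul_eq_mul, hs_mul β a x h.1 h.2.1, h.2.2 β hβ, mul_zero]

/-- the class of a linear polynomial -/
def ql (T : Matrix (Fin n) (Fin n) K) : (Fin n → K) →ₗ[K] NTAlg K T :=
  (Ideal.Quotient.mkₐ K (Ideal.span (relSet K T))).toLinearMap ∘ₗ lpol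

lemma ql_apply (T : Matrix (Fin n) (Fin n) K) (v) :
    ql T v = Ideal.Quotient.mk (Ideal.span (relSet K T)) (lpol v) := rfl

lemma ql_rel (T : Matrix (Fin n) (Fin n) K) (a b c d : Fin n → K) :
    ql T a * ql T b - ql T c * ql T d
      = Ideal.Quotient.mk (Ideal.span (relSet K T)) (lpol a * lpol b - lpol c * lpol d) := by
  simp [ql_apply]

lemma ql_ee (T : Matrix (Fin n) (Fin n) K) (i) : ql T (ee i) = NTgen K T i := by
  rw [ql_apply, lpol_ee]; rfl

lemma ql_sum (T : Matrix (Fin n) (Fin n) K) (v) : ql T v = ∑ i, v i • NTgen K T i := by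
  conv_lhs => rw [sum_ee v]
  simp [map_sum, ql_ee]

lemma ql_inj {T : Matrix (Fin n) (Fin n) K} (hT : SLTM K T) : Function.Injective (ql T) := by
  rw [injective_iff_map_eq_zero]
  intro v hv
  rw [ql_apply, Ideal.Quotient.eq_zero_iff_mem] at hv
  ext i
  have := (ideal_facts hT hv).2.1 i
  simpa [pderiv_lpol] using this

lemma exists_lift {T S : Matrix (Fin n) (Fin n) K} (e : NTAlg K T ≃ₐ[K] NTAlg K S)
    (he : ∀ j, e (NTgen K T j) ∈ Submodule.span K (Set.range (NTgen K S))) :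
    ∃ γ : (Fin n → K) →ₗ[K] (Fin n → K), ∀ v, e (ql T v) = ql S (γ v) := by
  have : ∀ j, ∃ c : Fin n → K, ql S c = e (NTgen K T j) := by
    intro j
    obtain ⟨c, hc⟩ := (Submodule.mem_span_range_iff_exists_fun K).1 (he j)
    exact ⟨c, by rw [ql_sum, hc]⟩
  choose c hc using this
  refine ⟨Fintype.linearCombination K c, fun v => ?_⟩
  rw [ql_sum, Fintype.linearCombination_apply]
  simp [map_sum, hc]

lemma pull_mem (h2 : (2 : K) ≠ 0) {T S : Matrix (Fin n) (Fin n) K} (hT : SLTM K T)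
    (hS : SLTM K S) (e : NTAlg K T ≃ₐ[K] NTAlg K S) (γ : (Fin n → K) →ₗ[K] (Fin n → K))
    (hγ : ∀ v, e (ql T v) = ql S (γ v)) {β} (hβ : β ∈ Bt S) : β.comp γ γ ∈ Bt T := by
  refine ⟨fun x y => hβ.1 _ _, fun r => ?_⟩
  have h0 : ql T (ee r) * ql T (ee r) - ql T (T r) * ql T (ee r) = 0 := by
    rw [ql_rel, Ideal.Quotient.eq_zero_iff_mem]
    refine Ideal.subset_span ⟨r, ?_⟩
    rw [row_sum hT, lpol_ee, sq]
  have h1 := congrArg e h0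
  rw [map_sub, map_mul, map_mul, map_zero, hγ, hγ] at h1
  rw [ql_rel, Ideal.Quotient.eq_zero_iff_mem] at h1
  have h3 := (ideal_facts hS h1).2.2 β hβ
  rw [hs_sub, hs_lpol β hβ.1, hs_lpol β hβ.1, ← mul_sub] at h3
  have := (mul_eq_zero.1 h3).resolve_left h2
  exact sub_eq_zero.1 this

lemma biso_of_ntiso (h2 : (2 : K) ≠ 0) {T S : Matrix (Fin n) (Fin n) K} (hT : SLTM K T)
    (hS : SLTM K S) (h : NTIso K T S) : BIso (Bt T) (Bt S) := by
  obtain ⟨e, he1, he2⟩ := h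
  obtain ⟨γ, hγ⟩ := exists_lift e he1
  obtain ⟨δ, hδ⟩ := exists_lift e.symm he2
  let Γ : (Fin n → K) ≃ₗ[K] (Fin n → K) := LinearEquiv.ofLinearMap γ δ
    (by
      ext1 v
      apply LinearMap.ext
      intro x
      apply ql_inj hS
      simp [← hγ, ← hδ])
    (by
      ext1 v
      apply LinearMap.ext
      intro x
      apply ql_inj hT
      simp [← hγ, ← hδ])
  exact ⟨Γ, fun β hβ => pull_mem h2 hT hS e γ hγ hβ, fun β hβ => pull_mem h2 hS hT e.symm δ hδ hβ⟩

/-! ### normal form -/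

/-- The matrix `T` whose forms are equivalent to `Bn N`. -/
def TT (N : Matrix (Fin n) (Fin n) K) : Matrix (Fin n) (Fin n) K := (2 : K) • (N * (1 + N)⁻¹)

lemma TT_mul {N : Matrix (Fin n) (Fin n) K} (hN : SLTM K N) : TT N * (1 + N) = (2 : K) • N := by
  rw [TT, Matrix.smul_mul, Matrix.mul_assoc, Matrix.nonsing_inv_mul _ (by simp [det_one_add hN]),
    Matrix.mul_one]

lemma TT_sltm {N : Matrix (Fin n) (Fin n) K} (hN : SLTM K N) : SLTM K (TT N) := by
  have hU : (1 + N)⁻¹ = 1 - N * (1 + N)⁻¹ := by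
    have : (1 + N) * (1 + N)⁻¹ = 1 := Matrix.mul_nonsing_inv _ (by simp [det_one_add hN])
    rw [add_mul, one_mul] at this
    exact eq_sub_of_add_eq this
  have key : ∀ i j, i ≤ j → (N * (1 + N)⁻¹) i j = 0 := by
    intro i
    induction i using WellFoundedLT.induction with
    | ind i ih =>
      intro j hij
      rw [Matrix.mul_apply]
      refine Finset.sum_eq_zero fun k _ => ?_
      by_cases hk : k < i
      · rw [hU, Matrix.sub_apply, ih k hk j (hk.le.trans hij), Matrix.one_apply_ne
          (hk.trans_le hij).ne]
        simp
      · rw [hN i k (not_lt.1 hk), zero_mul]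
  intro i j hij
  rw [TT, Matrix.smul_apply, key i j hij, smul_zero]

lemma biso_TT {N : Matrix (Fin n) (Fin n) K} (hN : SLTM K N) :
    BIso (Bt (TT N)) (Bn N) := by
  have u : IsUnit (1 + N).det := by simp [det_one_add hN]
  let φ : (Fin n → K) ≃ₗ[K] (Fin n → K) := LinearEquiv.ofLinearMap
    (Matrix.vecMulLinear (1 + N)) (Matrix.vecMulLinear (1 + N)⁻¹)
    (by
      apply LinearMap.ext; intro x
      change Matrix.vecMul (Matrix.vecMul x (1 + N)⁻¹) (1 + N) = x
      rw [Matrix.vecMul_vecMul, Matrix.nonsing_inv_mul _ u, Matrix.vecMul_one])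
    (by
      apply LinearMap.ext; intro x
      change Matrix.vecMul (Matrix.vecMul x (1 + N)) (1 + N)⁻¹ = x
      rw [Matrix.vecMul_vecMul, Matrix.mul_nonsing_inv _ u, Matrix.vecMul_one])
  have h1 : ∀ r, φ (ee r) = ee r + N r := by
    intro r
    change Matrix.vecMul (Pi.single r 1) (1 + N) = _
    rw [Matrix.single_one_vecMul]
    ext j
    simp [ee, Matrix.row, Matrix.one_apply, Pi.single_apply, eq_comm]
  have h3 : ∀ r, φ (TT N r) = (2 : K) • N r := by
    intro r
    change Matrix.vecMul (TT N r) (1 + N) = _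
    have : Matrix.vecMul (TT N r) (1 + N) = (TT N * (1 + N)) r := rfl
    rw [this, TT_mul hN]; rfl
  have key : ∀ β : LinearMap.BilinForm K (Fin n → K), (∀ x y, β x y = β y x) → ∀ r,
      (β (ee r) (ee r) = β (N r) (N r) ↔ β (φ (ee r)) (φ (ee r)) = β (φ (TT N r)) (φ (ee r))) := by
    intro β hβ r
    rw [h1, h3]
    simp only [map_add, map_smul, LinearMap.add_apply, LinearMap.smul_apply, smul_eq_mul]
    rw [hβ (ee r) (N r)]
    constructor <;> intro h <;> linear_combination h
  refine ⟨φ, ?_, ?_⟩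
  · intro β hβ
    exact ⟨fun x y => hβ.1 _ _, fun r => (key β hβ.1 r).1 (hβ.2 r)⟩
  · intro β hβ
    refine ⟨fun x y => hβ.1 _ _, fun r => ?_⟩
    refine (key (β.comp φ.symm.toLinearMap φ.symm.toLinearMap) (fun x y => hβ.1 _ _) r).2 ?_
    simpa using hβ.2 r

lemma biso_of_TT (h2 : (2 : K) ≠ 0) {N M : Matrix (Fin n) (Fin n) K} (hN : SLTM K N)
    (hM : SLTM K M) (h : NTIso K (TT N) (TT M)) : BIso (Bn N) (Bn M) :=
  ((biso_TT hN).symm.trans (biso_of_ntiso h2 (TT_sltm hN) (TT_sltm hM) h)).trans (biso_TT hM)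

/-! ### Catalan combinatorics -/

/-- The nondecreasing sequence attached to a binary tree. -/
def seqOf : BinaryTree Unit → List ℕ
  | .nil => []
  | .node _ l r => 0 :: (seqOf l ++ (seqOf r).map (fun x => x + (l.numNodes + 1)))

lemma seqOf_length (t : BinaryTree Unit) : (seqOf t).length = t.numNodes := by
  induction t with
  | nil => rfl
  | node a l r hl hr => simp [seqOf, BinaryTree.numNodes, hl, hr]

lemma seqOf_le (t : BinaryTree Unit) : ∀ i (h : i < (seqOf t).length), (seqOf t)[i] ≤ i := by
  induction t with
  | nil => intro i h; simp [seqOf] at h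
  | node a l r hl hr =>
    intro i h
    have e1 := seqOf_length l
    cases i with
    | zero => simp [seqOf]
    | succ i =>
      simp only [seqOf, List.getElem_cons_succ]
      by_cases hi : i < (seqOf l).length
      · rw [List.getElem_append_left hi]
        exact (hl i hi).trans (Nat.le_succ _)
      · rw [List.getElem_append_right (not_lt.1 hi), List.getElem_map]
        have := hr (i - (seqOf l).length) (by
          simp [seqOf] at h; omega)
        omega

lemma seqOf_sorted (t : BinaryTree Unit) : (seqOf t).Pairwise (· ≤ ·) := by
  induction t with
  | nil => simp [seqOf]
  | node a l r hl hr =>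
    simp only [seqOf, List.pairwise_cons, List.pairwise_append, List.pairwise_map]
    refine ⟨by simp, hl, hr.imp (by intro a b h; omega), ?_⟩
    intro x hx y hy
    obtain ⟨i, hi, rfl⟩ := List.getElem_of_mem hx
    rw [List.mem_map] at hy
    obtain ⟨z, hz, rfl⟩ := hy
    have := seqOf_le l i hi
    have e1 := seqOf_length l
    omega

lemma seq_aux {l r l' r' : BinaryTree Unit} 
    (h : seqOf l ++ (seqOf r).map (fun x => x + (l.numNodes + 1))
      = seqOf l' ++ (seqOf r').map (fun x => x + (l'.numNodes + 1))) :
    l'.numNodes ≤ l.numNodes := by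
  by_contra hlt
  push Not at hlt
  have e1 := seqOf_length l
  have e2 := seqOf_length l'
  have hlen := congrArg List.length h
  simp only [List.length_append, List.length_map] at hlen
  have h1 : (seqOf l).length < (seqOf l ++ (seqOf r).map (fun x => x + (l.numNodes + 1))).length := by
    simp only [List.length_append, List.length_map]; omega
  have h2 : (seqOf l).length < (seqOf l' ++ (seqOf r').map (fun x => x + (l'.numNodes + 1))).length := by
    simp only [List.length_append, List.length_map]; omega
  have h3 : (seqOf l ++ (seqOf r).map (fun x => x + (l.numNodes + 1)))[(seqOf l).length]
     = (seqOf l' ++ (seqOf r').map (fun x => x + (l'.numNodes + 1)))[(seqOf l).length] := by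
    simp only [h]
  rw [List.getElem_append_right le_rfl, List.getElem_append_left (by omega), List.getElem_map] at h3
  have := seqOf_le l' (seqOf l).length (by omega)
  omega

lemma seqOf_inj : ∀ t t' : BinaryTree Unit, seqOf t = seqOf t' → t = t' := by
  intro t
  induction t with
  | nil =>
    intro t' h
    cases t' with
    | nil => rfl
    | node a l r => simp [seqOf] at h
  | node a l r hl hr =>
    intro t' h
    cases t' with
    | nil => simp [seqOf] at h
    | node a' l' r' =>
      simp only [seqOf, List.cons.injEq, true_and] at h
      have e : l.numNodes = l'.numNodes := le_antisymm (seq_aux h.symm) (seq_aux h)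
      obtain ⟨h1, h2⟩ := List.append_inj h (by rw [seqOf_length, seqOf_length, e])
      have h3 := hl _ h1
      subst h3
      have h4 := hr _ (List.map_injective_iff.2 (add_left_injective _) h2)
      subst h4
      rfl

/-- the row parameter -/
def qf (t : BinaryTree Unit) (i : ℕ) : ℕ := (0 :: seqOf t).getD i 0

lemma qf_zero (t : BinaryTree Unit) : qf t 0 = 0 := rfl

lemma qf_le (t : BinaryTree Unit) (i : ℕ) : qf t i ≤ i - 1 := by
  cases i with
  | zero => simp [qf]
  | succ i =>
    simp only [qf, List.getD_cons_succ, Nat.add_sub_cancel]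
    by_cases h : i < (seqOf t).length
    · rw [List.getD_eq_getElem _ _ h]; exact seqOf_le t i h
    · rw [List.getD_eq_default _ _ (not_lt.1 h)]; omega

lemma qf_mono (t : BinaryTree Unit) {i j : ℕ} (hij : i ≤ j) (hj : j ≤ t.numNodes) :
    qf t i ≤ qf t j := by
  have hs : (0 :: seqOf t).Pairwise (· ≤ ·) := by simp [seqOf_sorted t]
  have hl : (0 :: seqOf t).length = t.numNodes + 1 := by simp [seqOf_length]
  rw [qf, qf, List.getD_eq_getElem _ _ (by omega), List.getD_eq_getElem _ _ (by omega)]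
  rcases hij.eq_or_lt with rfl | h
  · exact le_rfl
  · exact List.pairwise_iff_getElem.1 hs i j _ _ h

lemma qf_inj {t t' : BinaryTree Unit} (hn : t.numNodes = t'.numNodes)
    (h : ∀ i, i ≤ t.numNodes → qf t i = qf t' i) : t = t' := by
  apply seqOf_inj
  apply List.ext_getElem
  · rw [seqOf_length, seqOf_length, hn]
  · intro i h1 h2
    have := h (i + 1) (by rw [seqOf_length] at h1; omega)
    simpa only [qf, List.getD_cons_succ, List.getD_eq_getElem _ _ h1,
      List.getD_eq_getElem _ _ h2] using this

lemma count_lt_iff {q : ℕ → ℕ} (hq : ∀ i j, i ≤ j → j < n → q i ≤ q j) (k : ℕ) (s : Fin n) :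
    s.1 < (Finset.univ.filter fun i : Fin n => q i ≤ k).card ↔ q s ≤ k := by
  constructor
  · intro h
    by_contra hk
    have : (Finset.univ.filter fun i : Fin n => q i ≤ k) ⊆ Finset.Iio s := by
      intro i hi
      rw [Finset.mem_filter] at hi
      rw [Finset.mem_Iio]
      by_contra hsi
      exact hk ((hq s i (not_lt.1 hsi) i.2).trans hi.2)
    have := Finset.card_le_card this
    rw [Fin.card_Iio] at this
    omega
  · intro h
    have : Finset.Iic s ⊆ (Finset.univ.filter fun i : Fin n => q i ≤ k) := by
      intro i hi
      rw [Finset.mem_Iic] at hi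
      simpa using (hq i s hi s.2).trans h
    have := Finset.card_le_card this
    rw [Fin.card_Iic] at this
    omega

/-! ### the family -/

/-- staircase matrix -/
def stair (q : ℕ → ℕ) : Matrix (Fin n) (Fin n) K :=
  fun i j => if j.1 < i.1 ∧ j.1 ≤ q i.1 then 1 else 0

lemma stair_sltm (q : ℕ → ℕ) : SLTM K (stair q : Matrix (Fin n) (Fin n) K) := by
  intro i j h
  have : ¬ j.1 < i.1 := not_lt.2 h
  simp [stair, this]

lemma stair_card {q : ℕ → ℕ} (hq : ∀ i, q i ≤ i - 1) (i : Fin n) (k : ℕ) :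
    (supp ((stair q : Matrix (Fin n) (Fin n) K) i)).card ≤ k + 1 ↔ q i ≤ k := by
  have h := hq i
  have hi := i.2
  by_cases h0 : i.1 = 0
  · have h1 : q i = 0 := by omega
    have : supp ((stair q : Matrix (Fin n) (Fin n) K) i) = ∅ := by
      ext j
      rw [mem_supp]
      simp [stair, h0]
    rw [this, h1]; simp
  · have : supp ((stair q : Matrix (Fin n) (Fin n) K) i) = Finset.Iic ⟨q i, by omega⟩ := by
      ext j
      rw [mem_supp, Finset.mem_Iic, Fin.le_def]
      simp only [stair]
      constructor
      · intro h3
        by_contra h4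
        exact h3 (if_neg (fun h => h4 h.2))
      · intro h3
        change j.1 ≤ q i at h3
        rw [if_pos ⟨by omega, h3⟩]
        exact one_ne_zero
    rw [this, Fin.card_Iic]; simp

lemma coordSub_insert (S : Finset (Fin n)) (a : Fin n) :
    coordSub (insert a S) = coordSub (K := K) S ⊔ Submodule.span K {ee a} := by
  apply le_antisymm
  · rw [coordSub, Submodule.span_le]
    rintro _ ⟨⟨i, hi⟩, rfl⟩
    rw [Finset.mem_insert] at hi
    rcases hi with rfl | hi
    · exact Submodule.mem_sup_right (Submodule.mem_span_singleton_self _)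
    · exact Submodule.mem_sup_left (Submodule.subset_span ⟨⟨i, hi⟩, rfl⟩)
  · rw [sup_le_iff]
    constructor
    · intro v
      rw [mem_coordSub, mem_coordSub]
      intro h i hi
      exact h i (fun h => hi (by simp [h]))
    · rw [Submodule.span_le, Set.singleton_subset_iff]
      exact Submodule.subset_span ⟨⟨a, by simp⟩, rfl⟩

lemma coordSub_empty : coordSub (K := K) (∅ : Finset (Fin n)) = ⊥ := by
  rw [eq_bot_iff]
  intro v hv
  rw [mem_coordSub] at hv
  rw [Submodule.mem_bot]
  ext i
  exact hv i (by simp)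

lemma sqz_of_mem {N : Matrix (Fin n) (Fin n) K} {W} {v} (h : v ∈ W) : SqZ (Bn N) W v :=
  fun _ _ hW => hW v h v

lemma sqz_of_sub {N : Matrix (Fin n) (Fin n) K} {W} {v z} (h : v - z ∈ W)
    (hz : SqZ (Bn N) W z) : SqZ (Bn N) W v := by
  intro β hβ hW
  have := bil_add_rad hβ (z := z) (hW _ h)
  rw [sub_add_cancel] at this
  rw [this]
  exact hz β hβ hW

/-- initial segment -/
def seg (k : ℕ) : Finset (Fin n) := Finset.univ.filter fun j => j.1 < k

lemma mem_seg (k : ℕ) (j : Fin n) : j ∈ seg k ↔ j.1 < k := by simp [seg]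

lemma sqz_seg {q : ℕ → ℕ} (a : Fin n) :
    SqZ (Bn (stair q : Matrix (Fin n) (Fin n) K)) (coordSub (seg a.1)) (ee a) := by
  rw [sqz_ee]
  apply sqz_of_mem
  rw [mem_coordSub]
  intro i hi
  rw [mem_seg] at hi
  simp [stair, hi]

lemma feas_seg (q : ℕ → ℕ) (k : ℕ) :
    Feas (Bn (stair q : Matrix (Fin n) (Fin n) K)) k (coordSub (seg k)) := by
  induction k with
  | zero =>
    have : (seg 0 : Finset (Fin n)) = ∅ := by simp [seg]
    rw [this, coordSub_empty]
    exact Feas.nil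
  | succ k ih =>
    by_cases hk : k < n
    · have : (seg (k + 1) : Finset (Fin n)) = insert ⟨k, hk⟩ (seg k) := by
        ext i
        rw [mem_seg, Finset.mem_insert, mem_seg, Fin.ext_iff]
        simp only
        omega
      rw [this, coordSub_insert]
      exact Feas.cons ih (sqz_seg ⟨k, hk⟩)
    · have : (seg (k + 1) : Finset (Fin n)) = seg k := by
        ext i
        rw [mem_seg, mem_seg]
        have := i.2
        omega
      rw [this]
      exact Feas.skip ih

lemma stair_Dk (h2 : (2 : K) ≠ 0) {q : ℕ → ℕ} (hq : ∀ i, q i ≤ i - 1) (k : ℕ) :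
    Dk (Bn (stair q : Matrix (Fin n) (Fin n) K)) k
      = coordSub (Finset.univ.filter fun i : Fin n => q i ≤ k) := by
  apply le_antisymm
  · refine (Dk_le h2 (stair_sltm q) k).trans (le_of_eq ?_)
    congr 1
    ext i
    simp [stair_card hq]
  · rw [coordSub, Submodule.span_le]
    rintro _ ⟨⟨i, hi⟩, rfl⟩
    rw [Finset.mem_filter] at hi
    refine Submodule.subset_span ⟨_, feas_seg q k, ?_⟩
    change SqZ (Bn (stair q : Matrix (Fin n) (Fin n) K)) _ (ee i)
    rw [sqz_ee]
    by_cases hk : k < i.1 ∧ q i.1 = k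
    · refine sqz_of_sub (z := ee ⟨k, hk.1.trans i.2⟩) ?_ (sqz_seg ⟨k, hk.1.trans i.2⟩)
      rw [mem_coordSub]
      intro j hj
      rw [mem_seg] at hj
      by_cases hjk : j = ⟨k, hk.1.trans i.2⟩
      · subst hjk
        rw [Pi.sub_apply, ee_same]
        simp [stair, hk.1, hk.2]
      · rw [Pi.sub_apply, ee_ne hjk, sub_zero]
        rw [Fin.ext_iff] at hjk
        simp only at hjk
        exact if_neg (by omega)
    · apply sqz_of_mem
      rw [mem_coordSub]
      intro j hj
      rw [mem_seg] at hj
      have := hi.2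
      exact if_neg (by omega)

lemma sqz_smul {B : Set (LinearMap.BilinForm K (Fin n → K))} {W v} (c : K) (h : SqZ B W v) :
    SqZ B W (c • v) := by
  intro β hβ hW
  simp [h β hβ hW]

lemma sqz_mono {B : Set (LinearMap.BilinForm K (Fin n → K))} {W W' v} (hW : W ≤ W')
    (h : SqZ B W v) : SqZ B W' v :=
  fun β hβ h' => h β hβ (fun w hw => h' w (hW hw))

lemma span_top_of_ee {B : Set (LinearMap.BilinForm K (Fin n → K))} {W}
    (h : ∀ i, SqZ B W (ee i)) : Submodule.span K {v | SqZ B W v} = ⊤ := by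
  rw [eq_top_iff]
  intro v _
  rw [sum_ee v]
  exact Submodule.sum_mem _ fun i _ => Submodule.smul_mem _ _ (Submodule.subset_span (h i))

lemma feas_one {B : Set (LinearMap.BilinForm K (Fin n → K))} {a : Fin n}
    (h : SqZ B ⊥ (ee a)) : Feas B 1 (coordSub {a}) := by
  have := Feas.cons (Feas.nil (B := B)) h
  rw [← coordSub_empty, ← coordSub_insert] at this
  simpa using this

lemma stair_QQ {q : ℕ → ℕ} (hq : ∀ i, q i ≤ i - 1) (hn : 4 ≤ n) (h1 : ∀ i : Fin n, q i ≤ 1) :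
    QQ (Bn (stair q : Matrix (Fin n) (Fin n) K)) := by
  have hab : (⟨0, by omega⟩ : Fin n) ≠ ⟨1, by omega⟩ := by simp
  set a : Fin n := ⟨0, by omega⟩ with ha
  set b : Fin n := ⟨1, by omega⟩ with hb
  have s0 : SqZ (Bn (stair q : Matrix (Fin n) (Fin n) K)) ⊥ (ee a) := by
    rw [sqz_ee]
    apply sqz_of_mem
    rw [Submodule.mem_bot]
    ext j
    simp [stair, ha]
  have s1 : SqZ (Bn (stair q : Matrix (Fin n) (Fin n) K)) ⊥ (ee b) := by
    rw [sqz_ee]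
    refine sqz_of_sub (z := ee a) ?_ s0
    rw [Submodule.mem_bot, sub_eq_zero]
    ext j
    have := hq 1
    by_cases hj : j = a
    · subst hj; rw [ee_same]; exact if_pos (by simp [ha, hb])
    · rw [ee_ne hj]
      refine if_neg ?_
      rw [Fin.ext_iff] at hj
      simp only [ha, hb] at hj ⊢
      omega
  have key : ∀ x y : Fin n, (∀ j : Fin n, j.1 ≤ 1 → j = x ∨ j = y) →
      SqZ (Bn (stair q : Matrix (Fin n) (Fin n) K)) ⊥ (ee y) →
      Submodule.span K {v | SqZ (Bn (stair q : Matrix (Fin n) (Fin n) K)) (coordSub {x}) v} = ⊤ := by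
    intro x y hxy hy
    refine span_top_of_ee fun i => ?_
    rw [sqz_ee]
    refine sqz_of_sub (z := (stair q : Matrix (Fin n) (Fin n) K) i y • ee y) ?_
      (sqz_smul _ (sqz_mono bot_le hy))
    rw [mem_coordSub]
    intro j hj
    rw [Finset.mem_singleton] at hj
    by_cases hjy : j = y
    · subst hjy; simp [ee_same]
    · have h3 : ¬ j.1 ≤ 1 := fun h => (hxy j h).elim hj hjy
      have h4 := h1 i
      have : (stair q : Matrix (Fin n) (Fin n) K) i j = 0 := if_neg (by omega)
      simp [ee_ne hjy, this]
  refine ⟨coordSub {a}, coordSub {b}, ?_, feas_one s0, feas_one s1, key a b ?_ s1, key b a ?_ s0⟩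
  · intro h
    have : (ee a : Fin n → K) ∈ coordSub (K := K) {b} := by
      rw [← h, mem_coordSub]
      intro i hi
      exact ee_ne (by simpa using hi)
    rw [mem_coordSub] at this
    have := this a (by simpa using hab)
    rw [ee_same] at this
    exact one_ne_zero this
  · intro j hj
    rw [Fin.ext_iff, Fin.ext_iff]
    simp only [ha, hb]
    omega
  · intro j hj
    rw [Fin.ext_iff, Fin.ext_iff]
    simp only [ha, hb]
    omega

/-- the extra matrix -/
def Ex : Matrix (Fin n) (Fin n) K := fun i j =>
  if (i.1 + 2 = n ∧ j.1 ≤ 1) ∨ (i.1 + 1 = n ∧ (j.1 = 1 ∨ j.1 + 2 = n)) then 1 else 0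

lemma Ex_sltm (hn : 4 ≤ n) : SLTM K (Ex : Matrix (Fin n) (Fin n) K) := by
  intro i j h
  rw [Fin.le_def] at h
  exact if_neg (by omega)

lemma Ex_Dk (hn : 4 ≤ n) : Dk (Bn (Ex : Matrix (Fin n) (Fin n) K)) 1 = ⊤ := by
  have low : ∀ i : Fin n, i.1 + 2 < n →
      SqZ (Bn (Ex : Matrix (Fin n) (Fin n) K)) ⊥ (ee i) := by
    intro i hi
    rw [sqz_ee]
    apply sqz_of_mem
    rw [Submodule.mem_bot]
    ext j
    exact if_neg (by omega)
  set b : Fin n := ⟨1, by omega⟩ with hb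
  set a : Fin n := ⟨0, by omega⟩ with ha
  set c : Fin n := ⟨n - 2, by omega⟩ with hc
  have hF : Feas (Bn (Ex : Matrix (Fin n) (Fin n) K)) 1 (coordSub {b}) :=
    feas_one (low b (by simp only [hb]; omega))
  have gen : ∀ i z : Fin n, (Ex : Matrix (Fin n) (Fin n) K) i z = 1 →
      (∀ j, j ≠ b → j ≠ z → (Ex : Matrix (Fin n) (Fin n) K) i j = 0) →
      SqZ (Bn (Ex : Matrix (Fin n) (Fin n) K)) (coordSub {b}) (ee z) →
      SqZ (Bn (Ex : Matrix (Fin n) (Fin n) K)) (coordSub {b}) (ee i) := by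
    intro i z h1 h3 hz
    rw [sqz_ee]
    refine sqz_of_sub ?_ hz
    rw [mem_coordSub]
    intro j hj
    rw [Finset.mem_singleton] at hj
    by_cases hjz : j = z
    · subst hjz; rw [Pi.sub_apply, ee_same, h1, sub_self]
    · rw [Pi.sub_apply, ee_ne hjz, h3 j hj hjz, sub_zero]
  have hcz : SqZ (Bn (Ex : Matrix (Fin n) (Fin n) K)) (coordSub {b}) (ee c) := by
    refine gen c a ?_ ?_ (sqz_mono bot_le (low a (by simp only [ha]; omega)))
    · exact if_pos (by simp only [ha, hc]; omega)
    · intro j hj hja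
      rw [Ne, Fin.ext_iff] at hj hja
      simp only [ha, hb] at hj hja
      exact if_neg (by simp only [hc]; omega)
  have all : ∀ i, SqZ (Bn (Ex : Matrix (Fin n) (Fin n) K)) (coordSub {b}) (ee i) := by
    intro i
    have hi := i.2
    rcases lt_trichotomy (i.1 + 2) n with h | h | h
    · exact sqz_mono bot_le (low i h)
    · have : i = c := by rw [Fin.ext_iff]; simp only [hc]; omega
      rw [this]; exact hcz
    · refine gen i c ?_ ?_ hcz
      · exact if_pos (by simp only [hc]; omega)
      · intro j hj hja
        rw [Ne, Fin.ext_iff] at hj hja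
        simp only [hc, hb] at hj hja
        exact if_neg (by omega)
  rw [eq_top_iff, ← span_top_of_ee all]
  apply Submodule.span_mono
  intro v hv
  exact ⟨_, hF, hv⟩

lemma Ex_not_QQ (h2 : (2 : K) ≠ 0) (hn : 4 ≤ n) :
    ¬ QQ (Bn (Ex : Matrix (Fin n) (Fin n) K)) := by
  have hN := Ex_sltm (K := K) hn
  have hab : (⟨0, by omega⟩ : Fin n) ≠ ⟨1, by omega⟩ := by simp
  set a : Fin n := ⟨0, by omega⟩ with ha
  set b : Fin n := ⟨1, by omega⟩ with hb
  set c : Fin n := ⟨n - 2, by omega⟩ with hc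
  set d : Fin n := ⟨n - 1, by omega⟩ with hd
  have hbc : b ≠ c := by rw [Ne, Fin.ext_iff]; simp only [hb, hc]; omega
  have ca : a ∈ supp ((Ex : Matrix (Fin n) (Fin n) K) c) := by
    rw [mem_supp, show (Ex : Matrix (Fin n) (Fin n) K) c a = 1 from
      if_pos (by simp only [ha, hc]; omega)]
    exact one_ne_zero
  have cb : b ∈ supp ((Ex : Matrix (Fin n) (Fin n) K) c) := by
    rw [mem_supp, show (Ex : Matrix (Fin n) (Fin n) K) c b = 1 from
      if_pos (by simp only [hb, hc]; omega)]
    exact one_ne_zero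
  have db : b ∈ supp ((Ex : Matrix (Fin n) (Fin n) K) d) := by
    rw [mem_supp, show (Ex : Matrix (Fin n) (Fin n) K) d b = 1 from
      if_pos (Or.inr ⟨by simp only [hd]; omega, Or.inl rfl⟩)]
    exact one_ne_zero
  have dc : c ∈ supp ((Ex : Matrix (Fin n) (Fin n) K) d) := by
    rw [mem_supp, show (Ex : Matrix (Fin n) (Fin n) K) d c = 1 from
      if_pos (by simp only [hc, hd]; omega)]
    exact one_ne_zero
  have key : ∀ W, Feas (Bn (Ex : Matrix (Fin n) (Fin n) K)) 1 W →
      Submodule.span K {v | SqZ (Bn (Ex : Matrix (Fin n) (Fin n) K)) W v} = ⊤ →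
      W = coordSub {b} := by
    intro W hF ht
    obtain ⟨J, hG, hJ, hk⟩ := feas_good h2 hN hF
    have hcJ : c ∉ J := fun h => absurd (hk c h)
      (not_le.2 (Finset.one_lt_card.2 ⟨a, ca, b, cb, hab⟩))
    have hdJ : d ∉ J := fun h => absurd (hk d h)
      (not_le.2 (Finset.one_lt_card.2 ⟨b, db, c, dc, hbc⟩))
    have hex : ∃ v, SqZ (Bn (Ex : Matrix (Fin n) (Fin n) K)) W v ∧ v d ≠ 0 := by
      by_contra hcon
      push Not at hcon
      have hle : Submodule.span K {v | SqZ (Bn (Ex : Matrix (Fin n) (Fin n) K)) W v} ≤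
          LinearMap.ker (LinearMap.proj (R := K) (φ := fun _ : Fin n => K) d) := by
        rw [Submodule.span_le]
        intro v hv
        simpa using hcon v hv
      rw [ht] at hle
      have h3 := hle (Submodule.mem_top (x := (ee d : Fin n → K)))
      rw [LinearMap.mem_ker, LinearMap.proj_apply, ee_same] at h3
      exact one_ne_zero h3
    obtain ⟨v, hv, hvd⟩ := hex
    have h3 := lemB h2 hN hG hv hdJ hvd
    have hbJ : b ∈ J := by
      by_contra hbJ
      exact absurd h3 (not_le.2 (Finset.one_lt_card.2
        ⟨b, by simp [db, hbJ], c, by simp [dc, hcJ], hbc⟩))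
    have hJb : J = {b} := by
      symm
      apply Finset.eq_of_subset_of_card_le
      · simpa using hbJ
      · simpa using hJ
    ext x
    rw [hG.mem, mem_coordSub, hJb]
  rintro ⟨W₁, W₂, hne, f1, f2, t1, t2⟩
  exact hne ((key W₁ f1 t1).trans (key W₂ f2 t2).symm)

lemma stair_inj (h2 : (2 : K) ≠ 0) {t t' : BinaryTree Unit} (ht : t.numNodes + 1 = n)
    (ht' : t'.numNodes + 1 = n)
    (h : BIso (Bn (stair (qf t) : Matrix (Fin n) (Fin n) K))
      (Bn (stair (qf t') : Matrix (Fin n) (Fin n) K))) : t = t' := by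
  apply qf_inj (by omega)
  intro i hi
  have hin : i < n := by omega
  have m1 : ∀ i j, i ≤ j → j < n → qf t i ≤ qf t j := fun i j h1 h3 => qf_mono t h1 (by omega)
  have m2 : ∀ i j, i ≤ j → j < n → qf t' i ≤ qf t' j := fun i j h1 h3 => qf_mono t' h1 (by omega)
  have e : ∀ k, qf t i ≤ k ↔ qf t' i ≤ k := by
    intro k
    have h3 := h.finrank_eq k
    rw [stair_Dk h2 (qf_le t), stair_Dk h2 (qf_le t'), finrank_coordSub, finrank_coordSub] at h3
    have a1 := count_lt_iff m1 k ⟨i, hin⟩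
    have a2 := count_lt_iff m2 k ⟨i, hin⟩
    rw [h3] at a1
    exact a1.symm.trans a2
  exact le_antisymm ((e _).2 le_rfl) ((e _).1 le_rfl)

lemma stair_ne_Ex (h2 : (2 : K) ≠ 0) (hn : 4 ≤ n) (t : BinaryTree Unit)
    (h : BIso (Bn (stair (qf t) : Matrix (Fin n) (Fin n) K))
      (Bn (Ex : Matrix (Fin n) (Fin n) K))) : False := by
  refine Ex_not_QQ h2 hn (h.qq (stair_QQ (qf_le t) hn fun i => ?_))
  have h3 := h.finrank_eq 1
  rw [stair_Dk h2 (qf_le t), Ex_Dk hn, finrank_coordSub, finrank_top, Module.finrank_fin_fun] at h3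
  have h4 : (Finset.univ.filter fun i : Fin n => qf t i ≤ 1) = Finset.univ := by
    apply Finset.eq_univ_of_card
    rw [h3, Fintype.card_fin]
  have := Finset.mem_univ i
  rw [← h4, Finset.mem_filter] at this
  exact this.2

end Helpers

/-- For `n ≥ 4` the number of isomorphism classes of graded algebras `A(T)`, for
`T` a strictly lower triangular `n×n` matrix, is strictly greater than the
Catalan number `C_{n-1}`: there are `C_{n-1} + 1` pairwise non-isomorphic ones. -/
theorem stmt16 (h2 : (2 : F) ≠ 0) {n : ℕ} (hn : 4 ≤ n) :
    ∃ f : Fin (catalan (n - 1) + 1) → Matrix (Fin n) (Fin n) F,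
      (∀ x, SLTM F (f x)) ∧ ∀ x y, x ≠ y → ¬ NTIso F (f x) (f y) := by
  classical
  let m := n - 1
  let N : Option {t // t ∈ BinaryTree.treesOfNumNodesEq m} → Matrix (Fin n) (Fin n) F := fun o =>
    o.elim Ex (fun t => stair (qf t.1))
  have hN : ∀ o, SLTM F (N o) := by
    intro o
    cases o with
    | none => exact Ex_sltm hn
    | some t => exact stair_sltm _
  have hcard : Fintype.card (Option {t // t ∈ BinaryTree.treesOfNumNodesEq m})
      = catalan (n - 1) + 1 := by
    rw [Fintype.card_option, Fintype.card_coe, BinaryTree.treesOfNumNodesEq_card_eq_catalan]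
  let ε := (Fintype.equivFinOfCardEq hcard).symm
  refine ⟨fun x => TT (N (ε x)), fun x => TT_sltm (hN _), ?_⟩
  intro x y hxy hiso
  have hne : ε x ≠ ε y := fun h => hxy (ε.injective h)
  have hb := biso_of_TT h2 (hN _) (hN _) hiso
  generalize ε x = o at hne hb
  generalize ε y = o' at hne hb
  match o, o' with
  | none, none => exact hne rfl
  | none, some t => exact stair_ne_Ex h2 hn _ hb.symm
  | some t, none => exact stair_ne_Ex h2 hn _ hb
  | some t, some t' =>
    apply hne
    congr 1
    apply Subtype.ext
    have e1 := BinaryTree.mem_treesOfNumNodesEq.1 t.2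
    have e2 := BinaryTree.mem_treesOfNumNodesEq.1 t'.2
    exact stair_inj h2 (by omega) (by omega) hb
end
end
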